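/- arXiv:1407.0531 — 8 statements merged into one kernel-verified Lean document; each statement's English description precedes it below -/
import Mathlib

section
/- (Young-type inequality) Under the structure setting, for every ε with 0 < ε < 1 and all nonnegative real numbers σ1 and σ2 one has σ1·g(σ2) ≤ ε^{1−g1}·g1·G(σ1) + ε·g1·G(σ2). -/
open Real Set MeasureTheory

/-- Young-type inequality: Under the structure setting, for every
`ε` with `0 < ε < 1` and all `σ1, σ2 ≥ 0`,
`σ1 * g σ2 ≤ ε ^ (1 - g1) * g1 * G σ1 + ε * g1 * G σ2`. -/
theorem young_type_ineq
    (g0 g1 : ℝ) (hg0 : 1 < g0) (hg01 : g0 ≤ g1)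
    (g : ℝ → ℝ) (hgc : Continuous g)
    (hgmono : MonotoneOn g (Set.Ici 0))
    (hgnn : ∀ s : ℝ, 0 ≤ s → 0 ≤ g s)
    (hgpos : ∀ s : ℝ, 0 < s → 0 < g s)
    (G : ℝ → ℝ) (hG : ∀ σ : ℝ, G σ = ∫ s in (0:ℝ)..σ, g s)
    (hlow : ∀ σ : ℝ, 0 < σ → g0 * G σ ≤ σ * g σ)
    (hhigh : ∀ σ : ℝ, 0 < σ → σ * g σ ≤ g1 * G σ) :
    ∀ ε σ1 σ2 : ℝ, 0 < ε → ε < 1 → 0 ≤ σ1 → 0 ≤ σ2 →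
      σ1 * g σ2 ≤ ε ^ (1 - g1) * g1 * G σ1 + ε * g1 * G σ2 := by
  intro ε σ1 σ2 hε hε1 h1 h2
  have hg1 : 0 < g1 := by linarith
  have hGnn : ∀ σ : ℝ, 0 ≤ σ → 0 ≤ G σ := by
    intro σ hσ
    rw [hG]
    exact intervalIntegral.integral_nonneg hσ (fun u hu => hgnn u hu.1)
  have hGd : ∀ σ : ℝ, HasDerivAt G (g σ) σ := by
    intro σ
    have : G = fun σ => ∫ s in (0:ℝ)..σ, g s := funext hG
    rw [this]
    exact hgc.integral_hasStrictDerivAt 0 σ |>.hasDerivAt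
  have hd : ∀ t : ℝ, 0 < t → HasDerivAt (fun t => G t * t ^ (-g1))
      (g t * t ^ (-g1) + G t * (-g1 * t ^ (-g1 - 1))) t := by
    intro t ht
    exact (hGd t).mul (Real.hasDerivAt_rpow_const (Or.inl ht.ne'))
  have hanti : AntitoneOn (fun t => G t * t ^ (-g1)) (Set.Ioi 0) := by
    apply antitoneOn_of_deriv_nonpos (convex_Ioi 0)
    · intro t ht
      exact (hd t ht).continuousAt.continuousWithinAt
    · intro t ht
      rw [interior_Ioi] at ht
      exact (hd t ht).differentiableAt.differentiableWithinAt
    · intro t ht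
      rw [interior_Ioi] at ht
      have ht' : 0 < t := ht
      rw [(hd t ht).deriv]
      have e : t ^ (-g1) = t * t ^ (-g1 - 1) := by
        rw [Real.rpow_sub_one ht'.ne']
        field_simp
      have hp : 0 < t ^ (-g1 - 1) := Real.rpow_pos_of_pos ht' _
      rw [e]
      nlinarith [hhigh t ht', mul_le_mul_of_nonneg_right (hhigh t ht') hp.le]
  have hepos : 0 < ε ^ (1 - g1) := Real.rpow_pos_of_pos hε _
  have hA : 0 ≤ ε ^ (1 - g1) * g1 * G σ1 :=
    mul_nonneg (mul_nonneg hepos.le hg1.le) (hGnn _ h1)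
  have hB : 0 ≤ ε * g1 * G σ2 :=
    mul_nonneg (mul_nonneg hε.le hg1.le) (hGnn _ h2)
  rcases h1.eq_or_lt with h0 | hpos
  · rw [← h0] at hA ⊢
    linarith
  by_cases hc : σ1 ≤ ε * σ2
  · have h2' : 0 < σ2 := by
      by_contra hn
      nlinarith
    have a := mul_le_mul_of_nonneg_right hc (hgnn σ2 h2)
    have b := mul_le_mul_of_nonneg_left (hhigh σ2 h2') hε.le
    nlinarith
  · push Not at hc
    have hq : 0 < σ1 / ε := div_pos hpos hε
    have hle : σ2 ≤ σ1 / ε := by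
      rw [le_div_iff₀ hε]; linarith
    have hm : g σ2 ≤ g (σ1 / ε) := hgmono h2 hq.le hle
    have hs : σ1 ≤ σ1 / ε := by
      rw [le_div_iff₀ hε]; nlinarith
    have hk : G (σ1 / ε) * (σ1 / ε) ^ (-g1) ≤ G σ1 * σ1 ^ (-g1) := hanti hpos hq hs
    have hsp : 0 < σ1 ^ (-g1) := Real.rpow_pos_of_pos hpos _
    have hep : 0 < ε ^ (-g1) := Real.rpow_pos_of_pos hε _
    rw [Real.div_rpow hpos.le hε.le, ← mul_div_assoc, div_le_iff₀ hep] at hk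
    have hk2 : G (σ1 / ε) ≤ G σ1 * ε ^ (-g1) := by
      apply le_of_mul_le_mul_right _ hsp
      linarith
    have e1 : ε ^ (1 - g1) = ε * ε ^ (-g1) := by
      rw [sub_eq_add_neg, Real.rpow_add hε, Real.rpow_one]
    have hh := mul_le_mul_of_nonneg_left (hhigh _ hq) hε.le
    have e2 : ε * (σ1 / ε * g (σ1 / ε)) = σ1 * g (σ1 / ε) := by
      field_simp
    have h3 := mul_le_mul_of_nonneg_left hm hpos.le
    have h4 := mul_le_mul_of_nonneg_left hk2 (mul_pos hε hg1).le
    rw [e1] at hA ⊢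
    linarith
end

section
/- Under the structure setting, for every σ ≥ 0 one has g0·H(σ) ≤ G(σ) ≤ g1·H(σ). -/
open Real Set MeasureTheory

/-- Under the structure setting, with `h σ = G σ / σ` (and `h 0 = 0`) and
`H σ = ∫_0^σ h`, one has `g0 * H σ ≤ G σ ≤ g1 * H σ` for every `σ ≥ 0`. -/
theorem H_comparison
    (g0 g1 : ℝ) (hg0 : 1 < g0) (hg01 : g0 ≤ g1)
    (g : ℝ → ℝ) (hgc : Continuous g)
    (hgmono : MonotoneOn g (Set.Ici 0))
    (hgnn : ∀ s : ℝ, 0 ≤ s → 0 ≤ g s)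
    (hgpos : ∀ s : ℝ, 0 < s → 0 < g s)
    (G : ℝ → ℝ) (hG : ∀ σ : ℝ, G σ = ∫ s in (0:ℝ)..σ, g s)
    (hlow : ∀ σ : ℝ, 0 < σ → g0 * G σ ≤ σ * g σ)
    (hhigh : ∀ σ : ℝ, 0 < σ → σ * g σ ≤ g1 * G σ)
    (h : ℝ → ℝ) (hh0 : h 0 = 0) (hhpos : ∀ σ : ℝ, 0 < σ → h σ = G σ / σ)
    (H : ℝ → ℝ) (hH : ∀ σ : ℝ, H σ = ∫ s in (0:ℝ)..σ, h s) :
    ∀ σ : ℝ, 0 ≤ σ → g0 * H σ ≤ G σ ∧ G σ ≤ g1 * H σ := by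
  intro σ hσ
  have hGc : Continuous G := by
    have : G = fun x => ∫ s in (0:ℝ)..x, g s := funext hG
    rw [this]
    exact intervalIntegral.continuous_primitive (fun a b => hgc.intervalIntegrable a b) 0
  have hGnn : ∀ x, 0 ≤ x → 0 ≤ G x := by
    intro x hx
    rw [hG]
    exact intervalIntegral.integral_nonneg hx (fun u hu => hgnn u hu.1)
  have hg0' : 0 < g0 := by linarith
  have hlo : ∀ x, 0 < x → g0 * h x ≤ g x := by
    intro x hx
    rw [hhpos x hx, ← mul_div_assoc, div_le_iff₀ hx]
    linarith [hlow x hx]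
  have hhi : ∀ x, 0 < x → g x ≤ g1 * h x := by
    intro x hx
    rw [hhpos x hx, ← mul_div_assoc, le_div_iff₀ hx]
    linarith [hhigh x hx]
  have hgi : IntervalIntegrable g volume 0 σ := hgc.intervalIntegrable 0 σ
  have hhi' : IntervalIntegrable h volume 0 σ := by
    rw [intervalIntegrable_iff_integrableOn_Ioc_of_le hσ] at hgi ⊢
    have hq : IntegrableOn (fun x => G x / x) (Ioc 0 σ) volume := by
      refine Integrable.mono' hgi ?_ ?_
      · exact (hGc.measurable.div measurable_id).aestronglyMeasurable
      · refine (ae_restrict_iff' measurableSet_Ioc).2 (Filter.Eventually.of_forall ?_)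
        intro x hx
        have h1 := hlo x hx.1
        have h2 : 0 ≤ G x / x := div_nonneg (hGnn x hx.1.le) hx.1.le
        rw [hhpos x hx.1] at h1
        rw [Real.norm_of_nonneg h2]
        nlinarith
    exact hq.congr_fun (fun x hx => (hhpos x hx.1).symm) measurableSet_Ioc
  rw [hH, hG, ← intervalIntegral.integral_const_mul, ← intervalIntegral.integral_const_mul]
  constructor
  · exact intervalIntegral.integral_mono_on_of_le_Ioo hσ (hhi'.const_mul g0) hgi
      (fun x hx => hlo x hx.1)
  · exact intervalIntegral.integral_mono_on_of_le_Ioo hσ hgi (hhi'.const_mul g1)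
      (fun x hx => hhi x hx.1)
end

section
/- Under the structure setting, for every σ ≥ 0 one has (1/g1)·σ·h(σ) ≤ H(σ) ≤ (1/g0)·σ·h(σ). -/
open Real Set MeasureTheory

/-- Under the structure setting, for every `σ ≥ 0`,
`(1/g1) * σ * h σ ≤ H σ ≤ (1/g0) * σ * h σ`. -/
theorem H_sandwich
    (g0 g1 : ℝ) (hg0 : 1 < g0) (hg01 : g0 ≤ g1)
    (g : ℝ → ℝ) (hgc : Continuous g)
    (hgmono : MonotoneOn g (Set.Ici 0))
    (hgnn : ∀ s : ℝ, 0 ≤ s → 0 ≤ g s)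
    (hgpos : ∀ s : ℝ, 0 < s → 0 < g s)
    (G : ℝ → ℝ) (hG : ∀ σ : ℝ, G σ = ∫ s in (0:ℝ)..σ, g s)
    (hlow : ∀ σ : ℝ, 0 < σ → g0 * G σ ≤ σ * g σ)
    (hhigh : ∀ σ : ℝ, 0 < σ → σ * g σ ≤ g1 * G σ)
    (h : ℝ → ℝ) (hh0 : h 0 = 0) (hhpos : ∀ σ : ℝ, 0 < σ → h σ = G σ / σ)
    (H : ℝ → ℝ) (hH : ∀ σ : ℝ, H σ = ∫ s in (0:ℝ)..σ, h s) :
    ∀ σ : ℝ, 0 ≤ σ →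
      (1 / g1) * σ * h σ ≤ H σ ∧ H σ ≤ (1 / g0) * σ * h σ := by
  intro σ hσ
  have hg0p : 0 < g0 := by linarith
  have hg1p : 0 < g1 := by linarith
  rcases hσ.eq_or_lt with rfl | hσ
  · simp [hH, hh0]
  have hGc : Continuous G := by
    have : G = fun x => ∫ s in (0:ℝ)..x, g s := funext hG
    rw [this]
    exact intervalIntegral.continuous_primitive (fun a b => hgc.intervalIntegrable a b) 0
  have hGnn : ∀ s : ℝ, 0 < s → 0 ≤ G s := by
    intro s hs
    rw [hG]
    exact intervalIntegral.integral_nonneg hs.le (fun u hu => hgnn u hu.1)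
  have hl : ∀ s : ℝ, 0 < s → g0 * h s ≤ g s := by
    intro s hs
    rw [hhpos s hs, ← mul_div_assoc, div_le_iff₀ hs, mul_comm (g s)]
    exact hlow s hs
  have hu : ∀ s : ℝ, 0 < s → g s ≤ g1 * h s := by
    intro s hs
    rw [hhpos s hs, ← mul_div_assoc, le_div_iff₀ hs, mul_comm (g s)]
    exact hhigh s hs
  have hgi : IntervalIntegrable g volume 0 σ := hgc.intervalIntegrable _ _
  have hhi : IntervalIntegrable h volume 0 σ := by
    refine (hgi.const_mul (1 / g0)).mono_fun' ?_ ?_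
    · rw [uIoc_of_le hσ.le]
      have hm : Measurable (fun s => G s / s) := hGc.measurable.div measurable_id
      refine hm.aestronglyMeasurable.congr ?_
      filter_upwards [ae_restrict_mem measurableSet_Ioc] with s hs
      exact (hhpos s hs.1).symm
    · rw [uIoc_of_le hσ.le]
      filter_upwards [ae_restrict_mem measurableSet_Ioc] with s hs
      have h1 : 0 ≤ h s := by
        rw [hhpos s hs.1]
        exact div_nonneg (hGnn s hs.1) hs.1.le
      rw [Real.norm_of_nonneg h1, one_div, inv_mul_eq_div, le_div_iff₀ hg0p, mul_comm]
      exact hl s hs.1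
  have e : σ * h σ = G σ := by
    rw [hhpos σ hσ]; field_simp
  have A : g0 * H σ ≤ G σ := by
    rw [hH, hG, ← intervalIntegral.integral_const_mul]
    exact intervalIntegral.integral_mono_on_of_le_Ioo hσ.le (hhi.const_mul g0) hgi
      (fun s hs => hl s hs.1)
  have B : G σ ≤ g1 * H σ := by
    rw [hH, hG, ← intervalIntegral.integral_const_mul]
    exact intervalIntegral.integral_mono_on_of_le_Ioo hσ.le hgi (hhi.const_mul g1)
      (fun s hs => hu s hs.1)
  rw [mul_assoc, mul_assoc, e, one_div, one_div, inv_mul_eq_div, inv_mul_eq_div,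
    div_le_iff₀ hg1p, le_div_iff₀ hg0p]
  constructor <;> linarith
end

section
/- Under the structure setting, for all real numbers a and b with 0 < a < b: if g1 ≤ 2 then a²·G(a)^{-1} ≤ b²·G(b)^{-1}, and if g0 ≥ 2 then a²·G(a)^{-1} ≥ b²·G(b)^{-1}; that is, the map σ ↦ σ²/G(σ) is nondecreasing on (0,∞) when g1 ≤ 2 and nonincreasing on (0,∞) when g0 ≥ 2. -/
open Real Set MeasureTheory

/-- Under the structure setting, for `0 < a < b`: if `g1 ≤ 2` then
`a² * (G a)⁻¹ ≤ b² * (G b)⁻¹`, and if `g0 ≥ 2` then `a² * (G a)⁻¹ ≥ b² * (G b)⁻¹`;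
i.e. `σ ↦ σ²/G σ` is nondecreasing on `(0,∞)` when `g1 ≤ 2` and nonincreasing when
`g0 ≥ 2`. -/
theorem sq_div_G_monotone
    (g0 g1 : ℝ) (hg0 : 1 < g0) (hg01 : g0 ≤ g1)
    (g : ℝ → ℝ) (hgc : Continuous g)
    (hgmono : MonotoneOn g (Set.Ici 0))
    (hgnn : ∀ s : ℝ, 0 ≤ s → 0 ≤ g s)
    (hgpos : ∀ s : ℝ, 0 < s → 0 < g s)
    (G : ℝ → ℝ) (hG : ∀ σ : ℝ, G σ = ∫ s in (0:ℝ)..σ, g s)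
    (hlow : ∀ σ : ℝ, 0 < σ → g0 * G σ ≤ σ * g σ)
    (hhigh : ∀ σ : ℝ, 0 < σ → σ * g σ ≤ g1 * G σ) :
    (∀ a b : ℝ, 0 < a → a < b →
      (g1 ≤ 2 → a ^ 2 * (G a)⁻¹ ≤ b ^ 2 * (G b)⁻¹) ∧
      (2 ≤ g0 → b ^ 2 * (G b)⁻¹ ≤ a ^ 2 * (G a)⁻¹)) ∧
    (g1 ≤ 2 → MonotoneOn (fun σ : ℝ => σ ^ 2 / G σ) (Set.Ioi 0)) ∧
    (2 ≤ g0 → AntitoneOn (fun σ : ℝ => σ ^ 2 / G σ) (Set.Ioi 0)) := by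
  have hGpos : ∀ σ : ℝ, 0 < σ → 0 < G σ := by
    intro σ hσ
    have h1 := mul_pos hσ (hgpos σ hσ)
    have h2 := hhigh σ hσ
    exact pos_of_mul_pos_right (lt_of_lt_of_le h1 h2) (by linarith)
  have hGd : ∀ σ : ℝ, HasDerivAt G (g σ) σ := by
    intro σ
    have hfun : G = fun u => ∫ s in (0:ℝ)..u, g s := funext hG
    rw [hfun]
    exact (hgc.integral_hasStrictDerivAt 0 σ).hasDerivAt
  have hd : ∀ σ : ℝ, 0 < σ → HasDerivAt (fun σ : ℝ => σ ^ 2 / G σ)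
      (σ * (2 * G σ - σ * g σ) / G σ ^ 2) σ := by
    intro σ hσ
    have h := (hasDerivAt_pow 2 σ).div (hGd σ) (hGpos σ hσ).ne'
    refine h.congr_deriv ?_
    congr 1
    push_cast
    ring
  have hc : ContinuousOn (fun σ : ℝ => σ ^ 2 / G σ) (Set.Ioi 0) :=
    fun x hx => (hd x hx).continuousAt.continuousWithinAt
  have hdi : DifferentiableOn ℝ (fun σ : ℝ => σ ^ 2 / G σ) (interior (Set.Ioi 0)) := by
    rw [interior_Ioi]
    exact fun x hx => (hd x hx).differentiableAt.differentiableWithinAt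
  have hM : g1 ≤ 2 → MonotoneOn (fun σ : ℝ => σ ^ 2 / G σ) (Set.Ioi 0) := by
    intro h
    refine monotoneOn_of_deriv_nonneg (convex_Ioi 0) hc hdi ?_
    intro x hx
    rw [interior_Ioi] at hx
    have hx' : 0 < x := hx
    rw [(hd x hx').deriv]
    have h1 := hhigh x hx'
    have h2 := mul_le_mul_of_nonneg_right h (hGpos x hx').le
    exact div_nonneg (mul_nonneg hx'.le (by linarith)) (sq_nonneg _)
  have hA : 2 ≤ g0 → AntitoneOn (fun σ : ℝ => σ ^ 2 / G σ) (Set.Ioi 0) := by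
    intro h
    refine antitoneOn_of_deriv_nonpos (convex_Ioi 0) hc hdi ?_
    intro x hx
    rw [interior_Ioi] at hx
    have hx' : 0 < x := hx
    rw [(hd x hx').deriv]
    have h1 := hlow x hx'
    have h2 := mul_le_mul_of_nonneg_right h (hGpos x hx').le
    exact div_nonpos_of_nonpos_of_nonneg
      (mul_nonpos_of_nonneg_of_nonpos hx'.le (by linarith)) (sq_nonneg _)
  refine ⟨fun a b ha hab => ⟨fun h => ?_, fun h => ?_⟩, hM, hA⟩
  · have := hM h (Set.mem_Ioi.2 ha) (Set.mem_Ioi.2 (ha.trans hab)) hab.le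
    simpa only [div_eq_mul_inv] using this
  · have := hA h (Set.mem_Ioi.2 ha) (Set.mem_Ioi.2 (ha.trans hab)) hab.le
    simpa only [div_eq_mul_inv] using this
end

section
/- Under the structure setting, let r = (1 − g1)/g0 and s = g1 + (g1/g0)(g1 − 1). Then the maps σ ↦ G(σ)^{r−1}·σ^{s+2} and σ ↦ G(σ)^{r}·σ^{s} are nondecreasing on (0,∞). -/
open Real Set MeasureTheory

/-- Under the structure setting, with `r = (1 - g1)/g0` and
`s = g1 + (g1/g0)(g1 - 1)`, the maps `σ ↦ G σ ^ (r-1) * σ ^ (s+2)` and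
`σ ↦ G σ ^ r * σ ^ s` are nondecreasing on `(0,∞)` (real powers). -/
theorem power_maps_monotone
    (g0 g1 : ℝ) (hg0 : 1 < g0) (hg01 : g0 ≤ g1)
    (g : ℝ → ℝ) (hgc : Continuous g)
    (hgmono : MonotoneOn g (Set.Ici 0))
    (hgnn : ∀ s : ℝ, 0 ≤ s → 0 ≤ g s)
    (hgpos : ∀ s : ℝ, 0 < s → 0 < g s)
    (G : ℝ → ℝ) (hG : ∀ σ : ℝ, G σ = ∫ s in (0:ℝ)..σ, g s)
    (hlow : ∀ σ : ℝ, 0 < σ → g0 * G σ ≤ σ * g σ)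
    (hhigh : ∀ σ : ℝ, 0 < σ → σ * g σ ≤ g1 * G σ)
    (r s : ℝ) (hr : r = (1 - g1) / g0) (hs : s = g1 + g1 / g0 * (g1 - 1)) :
    MonotoneOn (fun σ : ℝ => G σ ^ (r - 1) * σ ^ (s + 2)) (Set.Ioi 0) ∧
    MonotoneOn (fun σ : ℝ => G σ ^ r * σ ^ s) (Set.Ioi 0) := by
  have hg1 : 0 < g1 := by linarith
  have hGpos : ∀ σ : ℝ, 0 < σ → 0 < G σ := by
    intro σ hσ
    have h1 := mul_pos hσ (hgpos σ hσ)
    have h2 := hhigh σ hσ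
    exact pos_of_mul_pos_right (lt_of_lt_of_le h1 h2) hg1.le
  have hGd : ∀ σ : ℝ, HasDerivAt G (g σ) σ := by
    intro σ
    have : G = fun σ => ∫ s in (0:ℝ)..σ, g s := funext hG
    rw [this]
    exact intervalIntegral.integral_hasDerivAt_right (hgc.intervalIntegrable _ _)
      (hgc.stronglyMeasurableAtFilter _ _) hgc.continuousAt
  have key : ∀ a b : ℝ, a ≤ 0 → 0 ≤ a * g1 + b →
      MonotoneOn (fun σ : ℝ => G σ ^ a * σ ^ b) (Set.Ioi 0) := by
    intro a b ha hab
    have hd : ∀ σ : ℝ, 0 < σ → HasDerivAt (fun σ : ℝ => G σ ^ a * σ ^ b)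
        (g σ * a * G σ ^ (a - 1) * σ ^ b + G σ ^ a * (b * σ ^ (b - 1))) σ := by
      intro σ hσ
      exact ((hGd σ).rpow_const (Or.inl (hGpos σ hσ).ne')).mul
        (Real.hasDerivAt_rpow_const (Or.inl hσ.ne'))
    refine monotoneOn_of_deriv_nonneg (convex_Ioi 0) ?_ ?_ ?_
    · intro σ hσ
      exact (hd σ hσ).continuousAt.continuousWithinAt
    · intro σ hσ
      rw [interior_Ioi] at hσ
      exact (hd σ hσ).differentiableAt.differentiableWithinAt
    · intro σ hσ
      rw [interior_Ioi] at hσ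
      have hσ' : 0 < σ := hσ
      rw [(hd σ hσ').deriv]
      have hp := hGpos σ hσ'
      have e1 : G σ ^ a = G σ ^ (a - 1) * G σ := by
        rw [← Real.rpow_add_one hp.ne']; simp
      have e2 : σ ^ b = σ ^ (b - 1) * σ := by
        rw [← Real.rpow_add_one hσ'.ne']; simp
      have e : g σ * a * G σ ^ (a - 1) * σ ^ b + G σ ^ a * (b * σ ^ (b - 1))
          = (G σ ^ (a - 1) * σ ^ (b - 1)) * (a * (σ * g σ) + b * G σ) := by
        rw [e1, e2]; ring
      rw [e]
      have h3 := mul_le_mul_of_nonpos_left (hhigh σ hσ') ha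
      have h4 := mul_nonneg hab hp.le
      have : 0 ≤ a * (σ * g σ) + b * G σ := by linarith
      have := Real.rpow_pos_of_pos hp (a - 1)
      have := Real.rpow_pos_of_pos hσ' (b - 1)
      positivity
  have hr0 : r ≤ 0 := by
    rw [hr]
    exact div_nonpos_of_nonpos_of_nonneg (by linarith) (by linarith)
  have hrs : r * g1 + s = g1 := by
    rw [hr, hs]; ring
  constructor
  · exact key _ _ (by linarith) (by linarith)
  · exact key _ _ hr0 (by linarith)
end

section
/- (Parabolic embedding) Let N ≥ 1 be an integer. There exists a constant C depending only on N with the following property: for every bounded open set K ⊂ ℝ^N, all reals t0 < t1, and every nonnegative continuously differentiable function v : ℝ^N × ℝ → ℝ such that v(x,t) = 0 whenever x ∉ K and t ∈ [t0,t1], one has ∫_{t0}^{t1}∫_K v dx dt ≤ C · ( meas{(x,t) ∈ K×[t0,t1] : v(x,t) > 0} )^{1/(N+1)} · ( sup_{t0 ≤ t ≤ t1} ∫_K v(x,t) dx )^{1/(N+1)} · ( ∫_{t0}^{t1}∫_K |D_x v| dx dt )^{N/(N+1)}, where D_x v denotes the spatial gradient of v and meas denotes (N+1)-dimensional Lebesgue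 measure. -/
open Real Set MeasureTheory

lemma slice_one (u : EuclideanSpace ℝ (Fin 1) → ℝ) (hu : ContDiff ℝ 1 u)
    (h2u : HasCompactSupport u) (x : EuclideanSpace ℝ (Fin 1)) :
    ‖u x‖ₑ ≤ ∫⁻ y, ‖fderiv ℝ u y‖ₑ := by
  let e : EuclideanSpace ℝ (Fin 1) := EuclideanSpace.single 0 1
  let φ : ℝ → EuclideanSpace ℝ (Fin 1) := fun s => s • e
  have hφe : φ = fun s => WithLp.toLp 2 ((MeasurableEquiv.funUnique (Fin 1) ℝ).symm s) := by
    funext s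
    ext i
    simp [φ, e, MeasurableEquiv.funUnique, Subsingleton.elim i 0]
  have hmp : MeasurePreserving φ volume volume := by
    rw [hφe]
    exact (PiLp.volume_preserving_toLp (Fin 1)).comp (volume_preserving_funUnique (Fin 1) ℝ).symm
  have hx : x = φ (x 0) := by
    ext i
    simp [φ, e, Subsingleton.elim i 0]
  have hne : ‖e‖ = 1 := by simp [e]
  have he0 : e ≠ 0 := by intro h; simp [h] at hne
  have hd : ∀ s, HasDerivAt φ e s := fun s => by
    simpa [φ] using (hasDerivAt_id s).smul_const e
  have hcl : Topology.IsClosedEmbedding φ := by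
    exact isClosedEmbedding_smul_left he0
  have hφc : ContDiff ℝ 1 φ := by fun_prop
  have h1 := HasCompactSupport.enorm_le_lintegral_Ici_deriv (f := u ∘ φ) (hu.comp hφc)
    (h2u.comp_isClosedEmbedding hcl) (x 0)
  rw [Function.comp_apply, ← hx] at h1
  refine h1.trans ?_
  rw [← hmp.lintegral_comp (f := fun y => ‖fderiv ℝ u y‖ₑ)
    ((hu.continuous_fderiv one_ne_zero).enorm.measurable)]
  refine (setLIntegral_le_lintegral _ _).trans (lintegral_mono fun s => ?_)
  have : deriv (u ∘ φ) s = fderiv ℝ u (φ s) e := by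
    exact (((hu.differentiable one_ne_zero).differentiableAt.hasFDerivAt).comp_hasDerivAt s
      (hd s)).deriv
  show ‖deriv (u ∘ φ) s‖ₑ ≤ _
  rw [this]
  refine (ContinuousLinearMap.le_opENorm _ _).trans ?_
  have : ‖e‖ₑ = 1 := by rw [← ofReal_norm, hne]; simp
  rw [this, mul_one]

lemma slice (N : ℕ) (hN : 1 ≤ N) : ∃ C : NNReal, ∀ u : EuclideanSpace ℝ (Fin N) → ℝ,
    ContDiff ℝ 1 u → HasCompactSupport u →
    ∫⁻ x, ‖u x‖ₑ ≤ C * (volume (Function.support u)) ^ ((1:ℝ)/N) * ∫⁻ x, ‖fderiv ℝ u x‖ₑ := by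
  rcases hN.eq_or_lt with rfl | hN
  · refine ⟨1, fun u hu h2u => ?_⟩
    have hs : ∫⁻ x, ‖u x‖ₑ = ∫⁻ x in Function.support u, ‖u x‖ₑ := by
      rw [setLIntegral_eq_of_support_subset]
      intro x hx; simpa using hx
    rw [hs]
    refine (lintegral_mono fun x => slice_one u hu h2u x).trans ?_
    rw [lintegral_const]
    simp [mul_comm]
  · have hN1 : (1:ℝ) < N := by exact_mod_cast hN
    let p : NNReal := NNReal.conjExponent N
    have hp : NNReal.HolderConjugate N p :=
      NNReal.HolderConjugate.conjExponent (by exact_mod_cast hN)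
    refine ⟨eLpNormLESNormFDerivOneConst (volume : Measure (EuclideanSpace ℝ (Fin N))) p, fun u hu h2u => ?_⟩
    have h := eLpNorm_le_eLpNorm_fderiv_one (volume : Measure (EuclideanSpace ℝ (Fin N))) hu h2u
      (p := p) (by simpa using hp)
    have hs : ∫⁻ x, ‖u x‖ₑ = ∫⁻ x in Function.support u, ‖u x‖ₑ := by
      rw [setLIntegral_eq_of_support_subset]
      intro x hx; simpa using hx
    have h2 := eLpNorm_le_eLpNorm_mul_rpow_measure_univ (p := 1) (q := (p : ENNReal)) (f := u)
      (μ := volume.restrict (Function.support u)) (by exact_mod_cast hp.symm.lt.le)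
      hu.continuous.aestronglyMeasurable
    rw [eLpNorm_one_eq_lintegral_enorm, ← hs] at h2
    rw [eLpNorm_one_eq_lintegral_enorm (f := fderiv ℝ u)] at h
    have hexp : (1:ℝ) / (1:ENNReal).toReal - 1 / (p:ENNReal).toReal = 1 / N := by
      have := hp.coe.inv_add_inv_eq_one
      simp at this ⊢
      linarith
    rw [hexp, Measure.restrict_apply_univ] at h2
    refine h2.trans ?_
    calc _ ≤ eLpNorm u p volume * volume (Function.support u) ^ ((1:ℝ) / N) := by
          gcongr; exact Measure.restrict_le_self
      _ ≤ _ := by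
          rw [mul_right_comm]; gcongr

section
variable {E H : Type*} [NormedAddCommGroup E] [NormedSpace ℝ E] [FiniteDimensional ℝ E]
  [MeasureSpace E] [BorelSpace E] [(volume : Measure E).IsAddHaarMeasure]
  [NormedAddCommGroup H]

lemma gen_fin (F : E × ℝ → H) (hF : Continuous F) (K : Set E)
    (hK : Bornology.IsBounded K) (t0 t1 : ℝ) :
    ∃ M : ENNReal, M < ⊤ ∧ ∀ t ∈ Icc t0 t1, ∫⁻ x in K, ‖F (x, t)‖ₑ ≤ M := by
  have hc : IsCompact (closure K ×ˢ Icc t0 t1) := hK.isCompact_closure.prod isCompact_Icc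
  obtain ⟨M, hM⟩ := hc.exists_bound_of_continuousOn hF.continuousOn
  refine ⟨ENNReal.ofReal M * volume K, ENNReal.mul_lt_top ENNReal.ofReal_lt_top
    hK.measure_lt_top, fun t ht => ?_⟩
  calc ∫⁻ x in K, ‖F (x, t)‖ₑ ≤ ∫⁻ x in K, ENNReal.ofReal M := by
          refine setLIntegral_mono measurable_const fun x hx => ?_
          rw [← ofReal_norm]
          exact ENNReal.ofReal_le_ofReal (hM _ ⟨subset_closure hx, ht⟩)
      _ = _ := by rw [setLIntegral_const]

lemma gen_meas (F : E × ℝ → H) (hF : Continuous F) (K : Set E) :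
    Measurable fun t => ∫⁻ x in K, ‖F (x, t)‖ₑ :=
  Measurable.lintegral_prod_left' (f := fun p => ‖F p‖ₑ) hF.enorm.measurable

lemma gen_conv (F : E × ℝ → H) (hF : Continuous F) (K : Set E)
    (hK : Bornology.IsBounded K) (t0 t1 : ℝ) (h : t0 < t1) :
    ∫ t in t0..t1, ∫ x in K, ‖F (x, t)‖ = (∫⁻ t in Ioc t0 t1, ∫⁻ x in K, ‖F (x, t)‖ₑ).toReal ∧
    ∫⁻ t in Ioc t0 t1, ∫⁻ x in K, ‖F (x, t)‖ₑ < ⊤ := by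
  obtain ⟨M, hM, hle⟩ := gen_fin F hF K hK t0 t1
  constructor
  · rw [intervalIntegral.integral_of_le h.le, ← integral_toReal (gen_meas F hF K).aemeasurable]
    · congr 1
      funext t
      exact integral_norm_eq_lintegral_enorm
        (hF.comp (by fun_prop : Continuous fun x : E => (x, t))).aestronglyMeasurable
    · filter_upwards [ae_restrict_mem measurableSet_Ioc] with t ht
      exact (hle t (Ioc_subset_Icc_self ht)).trans_lt hM
  · calc _ ≤ ∫⁻ t in Ioc t0 t1, M :=
          setLIntegral_mono measurable_const fun t ht => hle t (Ioc_subset_Icc_self ht)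
      _ < ⊤ := by
        rw [setLIntegral_const]
        exact ENNReal.mul_lt_top hM (by simp)
end

theorem parabolic_embedding (N : ℕ) (hN : 1 ≤ N) :
    ∃ C : ℝ, 0 < C ∧
    ∀ (K : Set (EuclideanSpace ℝ (Fin N))), IsOpen K → Bornology.IsBounded K →
    ∀ t0 t1 : ℝ, t0 < t1 →
    ∀ v : EuclideanSpace ℝ (Fin N) → ℝ → ℝ,
      ContDiff ℝ 1 (fun p : EuclideanSpace ℝ (Fin N) × ℝ => v p.1 p.2) →
      (∀ x t, 0 ≤ v x t) →
      (∀ x t, x ∉ K → t ∈ Set.Icc t0 t1 → v x t = 0) →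
      (∫ t in t0..t1, ∫ x in K, v x t) ≤
        C * (volume {p : EuclideanSpace ℝ (Fin N) × ℝ |
                p.1 ∈ K ∧ p.2 ∈ Set.Icc t0 t1 ∧ 0 < v p.1 p.2}).toReal ^ ((1:ℝ)/(N+1))
          * (⨆ t ∈ Set.Icc t0 t1, ∫ x in K, v x t) ^ ((1:ℝ)/(N+1))
          * (∫ t in t0..t1, ∫ x in K, ‖fderiv ℝ (fun y => v y t) x‖) ^ ((N:ℝ)/(N+1)) := by
  obtain ⟨C0, hC0⟩ := slice N hN
  refine ⟨((C0 + 1 : NNReal) : ℝ) ^ ((N:ℝ)/(N+1)), by positivity, ?_⟩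
  intro K hKo hKb t0 t1 ht v hV hnn hz
  have hN0 : (0:ℝ) < N := by exact_mod_cast hN
  have hF1 : Continuous fun p : EuclideanSpace ℝ (Fin N) × ℝ => v p.1 p.2 := hV.continuous
  have hD : Continuous fun p : EuclideanSpace ℝ (Fin N) × ℝ =>
      fderiv ℝ (fun y => v y p.2) p.1 := by
    have : (fun p : EuclideanSpace ℝ (Fin N) × ℝ => fderiv ℝ (fun y => v y p.2) p.1) =
        fun p => (fderiv ℝ (fun p : EuclideanSpace ℝ (Fin N) × ℝ => v p.1 p.2) p).comp
          (ContinuousLinearMap.inl ℝ _ _) := by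
      funext p
      have h1 : HasFDerivAt (fun p : EuclideanSpace ℝ (Fin N) × ℝ => v p.1 p.2)
          (fderiv ℝ (fun p : EuclideanSpace ℝ (Fin N) × ℝ => v p.1 p.2) p) (p.1, p.2) :=
        ((hV.differentiable one_ne_zero) p).hasFDerivAt
      have h2 : HasFDerivAt (fun y : EuclideanSpace ℝ (Fin N) => (y, p.2))
          (ContinuousLinearMap.inl ℝ (EuclideanSpace ℝ (Fin N)) ℝ) p.1 :=
        hasFDerivAt_prodMk_left p.1 p.2
      exact (HasFDerivAt.comp (f := fun y : EuclideanSpace ℝ (Fin N) => (y, p.2)) p.1 h1 h2).fderiv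
    rw [this]
    exact (hV.continuous_fderiv one_ne_zero).clm_comp continuous_const
  have hnorm : ∀ t x, v x t = ‖v x t‖ := fun t x => (Real.norm_of_nonneg (hnn x t)).symm
  obtain ⟨hI, hIfin⟩ := gen_conv _ hF1 K hKb t0 t1 ht
  obtain ⟨hG, hGfin⟩ := gen_conv _ hD K hKb t0 t1 ht
  obtain ⟨M, hM, hMle⟩ := gen_fin _ hF1 K hKb t0 t1
  simp only at hI hG hIfin hGfin hMle
  have hsl : ∀ t, ∫ x in K, v x t = (∫⁻ x in K, ‖v x t‖ₑ).toReal := by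
    intro t
    rw [integral_congr_ae (Filter.Eventually.of_forall (hnorm t)),
      integral_norm_eq_lintegral_enorm]
    · exact (hF1.comp (by fun_prop : Continuous fun x => (x, t))).aestronglyMeasurable
  have hI' : ∫ t in t0..t1, ∫ x in K, v x t =
      (∫⁻ t in Ioc t0 t1, ∫⁻ x in K, ‖v x t‖ₑ).toReal := by
    rw [← hI]; simp_rw [← hnorm]
  set S := ⨆ t ∈ Set.Icc t0 t1, ∫ x in K, v x t with hS
  have hSle : ∀ t ∈ Icc t0 t1, ∫ x in K, v x t ≤ S := by
    intro t ht'
    have hb : BddAbove (range fun t => ⨆ (_ : t ∈ Set.Icc t0 t1), ∫ x in K, v x t) := by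
      refine ⟨M.toReal, ?_⟩
      rintro _ ⟨s, rfl⟩
      refine Real.iSup_le (fun hs => ?_) ENNReal.toReal_nonneg
      rw [hsl]
      exact ENNReal.toReal_mono hM.ne (hMle s hs)
    refine le_trans ?_ (le_ciSup hb t)
    simp [ht']
  have hS0 : 0 ≤ S := by
    refine le_trans ?_ (hSle t0 ⟨le_rfl, ht.le⟩)
    exact integral_nonneg fun x => hnn x t0
  set B := {p : EuclideanSpace ℝ (Fin N) × ℝ | p.1 ∈ K ∧ p.2 ∈ Set.Icc t0 t1 ∧ 0 < v p.1 p.2}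
    with hB
  have hBm : MeasurableSet B := by
    refine (hKo.measurableSet.preimage measurable_fst).inter
      ((measurableSet_Icc.preimage measurable_snd).inter ?_)
    exact (isOpen_lt continuous_const hF1).measurableSet
  have hBfin : volume B < ⊤ := by
    refine Bornology.IsBounded.measure_lt_top
      ((hKb.prod (Metric.isBounded_Icc t0 t1)).subset ?_)
    rintro p ⟨h1, h2, -⟩
    exact ⟨h1, h2⟩
  have hBeq : volume B = ∫⁻ t, volume ((fun x => (x, t)) ⁻¹' B) :=
    Measure.prod_apply_symm hBm
  have hBmeas : Measurable fun t => volume ((fun x => (x, t)) ⁻¹' B) :=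
    measurable_measure_prodMk_right hBm
  have key : ∀ t ∈ Ioc t0 t1, ∫⁻ x in K, ‖v x t‖ₑ ≤
      ((C0 + 1 : NNReal) : ENNReal) ^ ((N:ℝ)/(N+1)) * ENNReal.ofReal S ^ ((1:ℝ)/(N+1)) *
      (volume ((fun x => (x, t)) ⁻¹' B) ^ ((1:ℝ)/(N+1)) *
        (∫⁻ x in K, ‖fderiv ℝ (fun y => v y t) x‖ₑ) ^ ((N:ℝ)/(N+1))) := by
    intro t ht'
    have htI := Ioc_subset_Icc_self ht'
    have hu : ContDiff ℝ 1 fun x => v x t :=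
      hV.comp (by fun_prop : ContDiff ℝ 1 fun x : EuclideanSpace ℝ (Fin N) => (x, t))
    have hsupp : HasCompactSupport fun x => v x t := by
      refine HasCompactSupport.intro hKb.isCompact_closure fun x hx => ?_
      exact hz x t (fun h => hx (subset_closure h)) htI
    have h := hC0 _ hu hsupp
    have e1 : ∫⁻ x, ‖v x t‖ₑ = ∫⁻ x in K, ‖v x t‖ₑ := by
      rw [setLIntegral_eq_of_support_subset]
      intro x hx
      by_contra hxK
      simp [hz x t hxK htI] at hx
    have e2 : ∫⁻ x, ‖fderiv ℝ (fun y => v y t) x‖ₑ =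
        ∫⁻ x in K, ‖fderiv ℝ (fun y => v y t) x‖ₑ := by
      rw [setLIntegral_eq_of_support_subset]
      intro x hx
      by_contra hxK
      have : fderiv ℝ (fun y => v y t) x = 0 := by
        refine IsLocalMin.fderiv_eq_zero (Filter.Eventually.of_forall fun y => ?_)
        simp only [hz x t hxK htI]
        exact hnn y t
      rw [Function.mem_support, this] at hx
      exact hx (by rw [← ofReal_norm, norm_zero, ENNReal.ofReal_zero])
    have e3 : Function.support (fun x => v x t) = (fun x => (x, t)) ⁻¹' B := by
      ext x
      simp only [Function.mem_support, mem_preimage, hB, mem_ofPred_eq]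
      constructor
      · intro hx
        refine ⟨?_, htI, lt_of_le_of_ne (hnn x t) (Ne.symm hx)⟩
        by_contra hxK
        exact hx (hz x t hxK htI)
      · rintro ⟨-, -, h⟩
        exact h.ne'
    rw [e1, e2, e3] at h
    have hIS : ∫⁻ x in K, ‖v x t‖ₑ ≤ ENNReal.ofReal S := by
      rw [ENNReal.le_ofReal_iff_toReal_le ((hMle t htI).trans_lt hM).ne hS0, ← hsl]
      exact hSle t htI
    generalize volume ((fun x => (x, t)) ⁻¹' B) = a at *
    generalize (∫⁻ x in K, ‖fderiv ℝ (fun y => v y t) x‖ₑ) = g at *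
    generalize ∫⁻ x in K, ‖v x t‖ₑ = i at *
    have h' : i ≤ ((C0 + 1 : NNReal) : ENNReal) * a ^ ((1:ℝ)/N) * g := by
      refine h.trans ?_
      gcongr
      simp
    calc i = i ^ ((1:ℝ)/(N+1)) * i ^ ((N:ℝ)/(N+1)) := by
          rw [← ENNReal.rpow_add_of_nonneg _ _ (by positivity) (by positivity)]
          have : (1:ℝ)/(N+1) + (N:ℝ)/(N+1) = 1 := by field_simp; ring
          rw [this, ENNReal.rpow_one]
      _ ≤ ENNReal.ofReal S ^ ((1:ℝ)/(N+1)) *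
          (((C0 + 1 : NNReal) : ENNReal) * a ^ ((1:ℝ)/N) * g) ^ ((N:ℝ)/(N+1)) := by
          gcongr
      _ = _ := by
          rw [ENNReal.mul_rpow_of_nonneg _ _ (by positivity),
            ENNReal.mul_rpow_of_nonneg _ _ (by positivity), ← ENNReal.rpow_mul]
          have : (1:ℝ)/N * ((N:ℝ)/(N+1)) = 1/(N+1) := by field_simp
          rw [this]
          ring
  have hGmeas := gen_meas _ hD K
  simp only at hGmeas
  have main : ∫⁻ t in Ioc t0 t1, ∫⁻ x in K, ‖v x t‖ₑ ≤
      ((C0 + 1 : NNReal) : ENNReal) ^ ((N:ℝ)/(N+1)) * ENNReal.ofReal S ^ ((1:ℝ)/(N+1)) *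
      (volume B ^ ((1:ℝ)/(N+1)) *
        (∫⁻ t in Ioc t0 t1, ∫⁻ x in K, ‖fderiv ℝ (fun y => v y t) x‖ₑ) ^ ((N:ℝ)/(N+1))) := by
    refine (setLIntegral_mono' measurableSet_Ioc key).trans ?_
    rw [lintegral_const_mul _ (by fun_prop)]
    gcongr
    refine (ENNReal.lintegral_mul_norm_pow_le hBmeas.aemeasurable hGmeas.aemeasurable
      (by positivity) (by positivity) (by field_simp; ring)).trans ?_
    gcongr
    rw [hBeq]
    exact setLIntegral_le_lintegral _ _
  rw [hI', hG]
  have hp1 : (0:ℝ) ≤ (1:ℝ)/(N+1) := by positivity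
  have hp2 : (0:ℝ) ≤ (N:ℝ)/(N+1) := by positivity
  have := ENNReal.toReal_mono (by
    refine ENNReal.mul_ne_top (ENNReal.mul_ne_top ?_ ?_) (ENNReal.mul_ne_top ?_ ?_)
    · exact ENNReal.rpow_ne_top_of_nonneg hp2 ENNReal.coe_ne_top
    · exact ENNReal.rpow_ne_top_of_nonneg hp1 ENNReal.ofReal_ne_top
    · exact ENNReal.rpow_ne_top_of_nonneg hp1 hBfin.ne
    · exact ENNReal.rpow_ne_top_of_nonneg hp2 hGfin.ne) main
  refine this.trans_eq ?_
  simp only [ENNReal.toReal_mul, ← ENNReal.toReal_rpow, ENNReal.toReal_ofReal hS0,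
    ENNReal.coe_toReal]
  ring
end

section
/- (De Giorgi–Poincaré inequality) Let N ≥ 1 be an integer. There exists a constant γ depending only on N with the following property: for every ρ > 0, every x0 ∈ ℝ^N, every continuous function v on the closure of the cube K = K_ρ^{x0} admitting an integrable weak gradient Dv on K (i.e. a locally integrable vector field Dv : K → ℝ^N with ∫_K v·∂φ/∂x_i dx = −∫_K (Dv)_i·φ dx for every smooth compactly supported φ : K → ℝ and every i), and all real numbers k < l such that meas{x ∈ K : v(x) > l} > 0, one has (l − k)·meas{x ∈ K : v(x) < k} ≤ γ·ρ^{N+1}·( meas{x ∈ K : v(x) > l} )^{−1} · ∫_{{x ∈ K : k < v(x) < l}} |Dv| dx. -/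
open Real Set MeasureTheory

/-- The open cube in `ℝ^N` of center `y` and half side-length `ρ`. -/
def cube (N : ℕ) (y : EuclideanSpace ℝ (Fin N)) (ρ : ℝ) : Set (EuclideanSpace ℝ (Fin N)) :=
  {x | ∀ i, |x i - y i| < ρ}


open scoped ENNReal

lemma dg_scale {N : ℕ} (H : EuclideanSpace ℝ (Fin N) → ℝ≥0∞) (hH : Measurable H) (c : ℝ)
    (hc : 1 / 2 ≤ c) (w : EuclideanSpace ℝ (Fin N)) :
    ∫⁻ x, H (c • x + w) ≤ 2 ^ N * ∫⁻ x, H x := by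
  have hc0 : c ≠ 0 := by linarith
  have h1 : ∫⁻ x, H (c • x + w) = ∫⁻ y, H (y + w) ∂(Measure.map (c • ·) volume) := by
    exact (lintegral_map (f := fun y => H (y + w)) (hH.comp (measurable_id.add_const w))
      (measurable_const_smul c)).symm
  rw [h1, Measure.map_addHaar_smul _ hc0, lintegral_smul_measure, lintegral_add_right_eq_self H w,
    smul_eq_mul]
  gcongr
  have h2 : |(c ^ Module.finrank ℝ (EuclideanSpace ℝ (Fin N)))⁻¹| ≤ 2 ^ N := by
    rw [finrank_euclideanSpace_fin, abs_of_nonneg (by positivity), ← inv_pow]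
    gcongr
    rw [inv_le_comm₀ (by linarith) (by norm_num)]
    linarith
  calc _ ≤ ENNReal.ofReal (2 ^ N) := ENNReal.ofReal_le_ofReal h2
    _ = 2 ^ N := by rw [ENNReal.ofReal_pow (by norm_num)]; simp

lemma dg_scale' {N : ℕ} (s : Set (EuclideanSpace ℝ (Fin N))) (hs : MeasurableSet s)
    (h : EuclideanSpace ℝ (Fin N) → ℝ≥0∞) (hh : Measurable h) (c : ℝ)
    (hc : 1 / 2 ≤ c) (w : EuclideanSpace ℝ (Fin N)) (hw : ∀ x ∈ s, c • x + w ∈ s) :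
    ∫⁻ x in s, h (c • x + w) ≤ 2 ^ N * ∫⁻ x in s, h x := by
  calc _ ≤ ∫⁻ x, (s.indicator h) (c • x + w) := by
        rw [← lintegral_indicator hs]
        refine lintegral_mono fun x => ?_
        by_cases hx : x ∈ s
        · simp [hx, hw x hx]
        · simp [hx]
    _ ≤ _ := by
        rw [← lintegral_indicator hs]
        exact dg_scale _ (hh.indicator hs) c hc w

lemma dg_seg {N : ℕ} (F : EuclideanSpace ℝ (Fin N) → ℝ) (hF : ContDiff ℝ 1 F) (d : ℝ)
    (x y : EuclideanSpace ℝ (Fin N)) (hd : ‖y - x‖ ≤ d) :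
    ‖F y - F x‖ₑ ≤ ENNReal.ofReal d *
      ∫⁻ t in Ioc (0:ℝ) 1, ‖fderiv ℝ F ((1 - t) • x + t • y)‖ₑ := by
  have hcf : Continuous (fderiv ℝ F) := hF.continuous_fderiv (by norm_num)
  have hder : ∀ t : ℝ, HasDerivAt (fun t : ℝ => F ((1 - t) • x + t • y))
      (fderiv ℝ F ((1 - t) • x + t • y) (y - x)) t := by
    intro t
    have h1 : HasDerivAt (fun t : ℝ => (1 - t) • x + t • y) (y - x) t := by
      have := (((hasDerivAt_id t).const_sub 1).smul_const x).add ((hasDerivAt_id t).smul_const y)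
      have e : y - x = (-1 : ℝ) • x + (1 : ℝ) • y := by
        rw [neg_one_smul, one_smul]; abel
      rw [e]
      exact this
    exact ((hF.differentiable (by norm_num)) _).hasFDerivAt.comp_hasDerivAt t h1
  have hint := intervalIntegral.integral_eq_sub_of_hasDerivAt (a := (0:ℝ)) (b := 1)
    (fun t _ => hder t) (Continuous.intervalIntegrable (by fun_prop) _ _)
  simp only [one_smul, zero_smul, sub_self, sub_zero, zero_add, add_zero] at hint
  rw [← hint, intervalIntegral.integral_of_le zero_le_one]
  refine (enorm_integral_le_lintegral_enorm _).trans ?_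
  rw [← lintegral_const_mul _ (by fun_prop)]
  refine lintegral_mono fun t => ?_
  refine (ContinuousLinearMap.le_opENorm _ _).trans ?_
  rw [mul_comm]
  gcongr
  rw [← ofReal_norm]
  exact ENNReal.ofReal_le_ofReal hd

lemma dg_poin {N : ℕ} (s : Set (EuclideanSpace ℝ (Fin N))) (hs : MeasurableSet s)
    (hconv : Convex ℝ s) (d : ℝ) (hd : ∀ x ∈ s, ∀ y ∈ s, ‖y - x‖ ≤ d)
    (F : EuclideanSpace ℝ (Fin N) → ℝ) (hF : ContDiff ℝ 1 F) :
    ∫⁻ x in s, ∫⁻ y in s, ‖F y - F x‖ₑ ≤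
      ENNReal.ofReal d * (2 ^ N * volume s * ∫⁻ z in s, ‖fderiv ℝ F z‖ₑ) := by
  have hcf : Continuous (fderiv ℝ F) := hF.continuous_fderiv (by norm_num)
  set h : EuclideanSpace ℝ (Fin N) → ℝ≥0∞ := fun z => ‖fderiv ℝ F z‖ₑ with hh
  have hhc : Continuous h := hcf.enorm
  have hhm : Measurable h := hhc.measurable
  have key : ∀ t ∈ Ioc (0:ℝ) 1, ∫⁻ x in s, ∫⁻ y in s, h ((1 - t) • x + t • y) ≤
      2 ^ N * volume s * ∫⁻ z in s, h z := by
    intro t ht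
    rcases le_total t (1/2) with h2 | h2
    · rw [lintegral_lintegral_swap
        (Continuous.aemeasurable (by unfold Function.uncurry; fun_prop))]
      calc _ ≤ ∫⁻ y in s, 2 ^ N * ∫⁻ z in s, h z := by
            refine setLIntegral_mono' hs fun y hy => ?_
            refine dg_scale' s hs h hhm (1 - t) (by linarith) (t • y) fun x hx => ?_
            exact hconv hx hy (by linarith [ht.2]) ht.1.le (by ring)
        _ = _ := by rw [setLIntegral_const]; ring
    · calc _ ≤ ∫⁻ y in s, 2 ^ N * ∫⁻ z in s, h z := by
            refine setLIntegral_mono' hs fun x hx => ?_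
            simp_rw [add_comm ((1 - t) • x)]
            refine dg_scale' s hs h hhm t (by linarith) ((1 - t) • x) fun y hy => ?_
            exact hconv hy hx ht.1.le (by linarith [ht.2]) (by ring)
        _ = _ := by rw [setLIntegral_const]; ring
  calc _ ≤ ∫⁻ x in s, ∫⁻ y in s, ENNReal.ofReal d *
            ∫⁻ t in Ioc (0:ℝ) 1, h ((1 - t) • x + t • y) :=
        setLIntegral_mono' hs fun x hx => setLIntegral_mono' hs fun y hy =>
          dg_seg F hF d x y (hd x hx y hy)
    _ = ENNReal.ofReal d * ∫⁻ x in s, ∫⁻ y in s,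
            ∫⁻ t in Ioc (0:ℝ) 1, h ((1 - t) • x + t • y) := by
        rw [← lintegral_const_mul' _ _ ENNReal.ofReal_ne_top]
        refine lintegral_congr fun x => ?_
        rw [lintegral_const_mul' _ _ ENNReal.ofReal_ne_top]
    _ = ENNReal.ofReal d * ∫⁻ t in Ioc (0:ℝ) 1, ∫⁻ x in s, ∫⁻ y in s,
            h ((1 - t) • x + t • y) := by
        congr 1
        have e1 : ∀ x, ∫⁻ y in s, ∫⁻ t in Ioc (0:ℝ) 1, h ((1 - t) • x + t • y) =
            ∫⁻ t in Ioc (0:ℝ) 1, ∫⁻ y in s, h ((1 - t) • x + t • y) := fun x =>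
          lintegral_lintegral_swap
            (Continuous.aemeasurable (by unfold Function.uncurry; fun_prop))
        simp_rw [e1]
        refine lintegral_lintegral_swap (Measurable.aemeasurable ?_)
        have hm : Measurable fun q : (EuclideanSpace ℝ (Fin N) × ℝ) × EuclideanSpace ℝ (Fin N) =>
            h ((1 - q.1.2) • q.1.1 + q.1.2 • q.2) := Continuous.measurable (by fun_prop)
        exact hm.lintegral_prod_right'
    _ ≤ ENNReal.ofReal d * ∫⁻ t in Ioc (0:ℝ) 1, 2 ^ N * volume s * ∫⁻ z in s, h z := by
        refine mul_le_mul_right ?_ _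
        exact setLIntegral_mono' measurableSet_Ioc key
    _ = _ := by simp

open scoped Convolution in
lemma dg_moll {N : ℕ} (K : Set (EuclideanSpace ℝ (Fin N))) (hK : IsOpen K)
    (v : EuclideanSpace ℝ (Fin N) → ℝ) (hV : Integrable (K.indicator v))
    (G : EuclideanSpace ℝ (Fin N) → EuclideanSpace ℝ (Fin N)) (hG : IntegrableOn G K)
    (hw : ∀ φ : EuclideanSpace ℝ (Fin N) → ℝ, ContDiff ℝ (⊤ : ℕ∞) φ → HasCompactSupport φ →
        tsupport φ ⊆ K → ∀ i : Fin N,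
        (∫ x in K, v x * fderiv ℝ φ x (EuclideanSpace.single i 1)) = - ∫ x in K, G x i * φ x)
    (η : ContDiffBump (0 : EuclideanSpace ℝ (Fin N))) (x : EuclideanSpace ℝ (Fin N))
    (hx : Metric.closedBall x η.rOut ⊆ K) :
    ‖fderiv ℝ (η.normed volume ⋆[ContinuousLinearMap.lsmul ℝ ℝ, volume] K.indicator v) x‖ₑ ≤
      ∫⁻ y in K, ENNReal.ofReal (η.normed volume (x - y)) * ‖G y‖ₑ := by
  set ψ := η.normed (volume : Measure (EuclideanSpace ℝ (Fin N))) with hψ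
  have hψs : ContDiff ℝ (⊤ : ℕ∞) ψ := η.contDiff_normed
  have hψc : HasCompactSupport ψ := η.hasCompactSupport_normed
  have hψ0 : ∀ y, 0 ≤ ψ y := fun y => η.nonneg_normed y
  have hd := hψc.hasFDerivAt_convolution_left (ContinuousLinearMap.lsmul ℝ ℝ)
    (hψs.of_le (by exact_mod_cast le_top)) hV.locallyIntegrable x
  have hφs : ContDiff ℝ (⊤ : ℕ∞) (fun y => ψ (x - y)) := hψs.comp (contDiff_const.sub contDiff_id)
  have hsupp : tsupport (fun y => ψ (x - y)) ⊆ Metric.closedBall x η.rOut := by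
    refine closure_minimal (fun y hy => ?_) Metric.isClosed_closedBall
    have h1 : x - y ∈ Function.support ψ := hy
    rw [hψ, η.support_normed_eq] at h1
    rw [Metric.mem_closedBall, dist_comm, dist_eq_norm]
    simpa using (Metric.mem_ball.1 h1).le
  have hφc : HasCompactSupport (fun y => ψ (x - y)) :=
    HasCompactSupport.of_support_subset_isCompact (isCompact_closedBall x η.rOut)
      ((subset_tsupport _).trans hsupp)
  have hi : IntegrableOn (fun y => ψ (x - y) • G y) K := by
    obtain ⟨C, hC⟩ := hφc.exists_bound_of_continuous hφs.continuous
    exact Integrable.bdd_smul hG C hφs.continuous.aestronglyMeasurable.restrict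
      (Filter.Eventually.of_forall hC)
  have hfd : ∀ y w, fderiv ℝ (fun y => ψ (x - y)) y w = - fderiv ℝ ψ (x - y) w := by
    intro y w
    have h1 : HasFDerivAt (fun y => x - y)
      (-(ContinuousLinearMap.id ℝ (EuclideanSpace ℝ (Fin N)))) y := (hasFDerivAt_id y).const_sub x
    have h2 := ((hψs.differentiable (by simp)) (x - y)).hasFDerivAt.comp y h1
    have h3 := h2.fderiv
    change fderiv ℝ (fun y => ψ (x - y)) y = _ at h3
    rw [h3]; simp
  set g : EuclideanSpace ℝ (Fin N) := ∫ y in K, ψ (x - y) • G y with hg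
  have heq : fderiv ℝ (ψ ⋆[ContinuousLinearMap.lsmul ℝ ℝ, volume] K.indicator v) x
      = innerSL ℝ g := by
    rw [hd.fderiv]
    have hce := (hψc.fderiv (𝕜 := ℝ)).convolutionExists_left
      ((ContinuousLinearMap.lsmul ℝ ℝ).precompL (EuclideanSpace ℝ (Fin N)))
      (hψs.continuous_fderiv (by simp)) hV.locallyIntegrable x
    refine ContinuousLinearMap.coe_injective
      ((EuclideanSpace.basisFun (Fin N) ℝ).toBasis.ext fun i => ?_)
    simp only [OrthonormalBasis.coe_toBasis, EuclideanSpace.basisFun_apply,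
      ContinuousLinearMap.coe_coe, innerSL_apply_apply]
    rw [convolution_eq_swap, ContinuousLinearMap.integral_apply]
    · have e1 : inner ℝ g (EuclideanSpace.single i (1:ℝ)) = g i := by
        simp [EuclideanSpace.inner_single_right]
      have e2 : g i = ∫ y in K, G y i * ψ (x - y) := by
        have := (EuclideanSpace.proj i : EuclideanSpace ℝ (Fin N) →L[ℝ] ℝ).integral_comp_comm hi
        change _ = g i at this
        rw [← this]
        refine integral_congr_ae (Filter.Eventually.of_forall fun y => ?_)
        simp [mul_comm]
      have e3 := hw _ hφs hφc (hsupp.trans hx) i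
      rw [e1, e2, ← neg_eq_iff_eq_neg.2 e3, ← integral_neg, ← integral_indicator hK.measurableSet]
      refine integral_congr_ae (Filter.Eventually.of_forall fun y => ?_)
      simp only [hfd]
      by_cases hy : y ∈ K
      · simp [hy, ContinuousLinearMap.precompL_apply, mul_comm]
      · simp [hy]
    · exact hce.integrable_swap
  rw [heq]
  have : ‖innerSL ℝ g‖ₑ = ‖g‖ₑ := by
    rw [← ofReal_norm, ← ofReal_norm, innerSL_apply_norm]
  rw [this]
  refine (enorm_integral_le_lintegral_enorm _).trans (lintegral_mono fun y => ?_)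
  rw [enorm_smul, Real.enorm_of_nonneg (hψ0 _)]

open scoped Convolution in
lemma dg_grad {N : ℕ} (K : Set (EuclideanSpace ℝ (Fin N))) (hK : IsOpen K)
    (v : EuclideanSpace ℝ (Fin N) → ℝ) (hV : Integrable (K.indicator v))
    (G : EuclideanSpace ℝ (Fin N) → EuclideanSpace ℝ (Fin N)) (hG : IntegrableOn G K)
    (hw : ∀ φ : EuclideanSpace ℝ (Fin N) → ℝ, ContDiff ℝ (⊤ : ℕ∞) φ → HasCompactSupport φ →
        tsupport φ ⊆ K → ∀ i : Fin N,
        (∫ x in K, v x * fderiv ℝ φ x (EuclideanSpace.single i 1)) = - ∫ x in K, G x i * φ x)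
    (η : ContDiffBump (0 : EuclideanSpace ℝ (Fin N))) (S : Set (EuclideanSpace ℝ (Fin N)))
    (hS : MeasurableSet S)
    (hx : ∀ x ∈ S, Metric.closedBall x η.rOut ⊆ K) (f : ℝ → ℝ) (hf : ContDiff ℝ 1 f) (δ : ℝ≥0∞)
    (u : EuclideanSpace ℝ (Fin N) → ℝ)
    (hu : u = η.normed volume ⋆[ContinuousLinearMap.lsmul ℝ ℝ, volume] K.indicator v)
    (huc : ContDiff ℝ 1 u)
    (hfu : ∀ x ∈ S, ∀ y ∈ K, dist x y < η.rOut →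
      ‖deriv f (u x)‖ₑ ≤ ‖deriv f (v y)‖ₑ + δ) :
    ∫⁻ x in S, ‖fderiv ℝ (fun x => f (u x)) x‖ₑ ≤
      ∫⁻ y in K, ‖G y‖ₑ * (‖deriv f (v y)‖ₑ + δ) := by
  set ψ := η.normed (volume : Measure (EuclideanSpace ℝ (Fin N))) with hψ
  have hψs : ContDiff ℝ (⊤ : ℕ∞) ψ := η.contDiff_normed
  have hψcont : Continuous ψ := hψs.continuous
  have hψ0 : ∀ y, 0 ≤ ψ y := fun y => η.nonneg_normed y
  have hψ1 : ∫⁻ y, ENNReal.ofReal (ψ y) = 1 := by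
    rw [← ofReal_integral_eq_lintegral_ofReal η.integrable_normed
      (Filter.Eventually.of_forall hψ0), η.integral_normed]
    simp
  have hfc : Continuous (deriv f) := hf.continuous_deriv (by norm_num)
  have hucont : Continuous u := huc.continuous
  calc _ ≤ ∫⁻ x in S, ∫⁻ y in K,
          ‖deriv f (u x)‖ₑ * (ENNReal.ofReal (ψ (x - y)) * ‖G y‖ₑ) := by
        refine setLIntegral_mono' hS fun x hxS => ?_
        rw [lintegral_const_mul' _ _ enorm_ne_top]
        have h1 : fderiv ℝ (fun x => f (u x)) x = deriv f (u x) • fderiv ℝ u x :=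
          (((hf.differentiable (by norm_num)) (u x)).hasDerivAt.comp_hasFDerivAt x
            ((huc.differentiable (by norm_num)) x).hasFDerivAt).fderiv
        rw [h1, enorm_smul]
        gcongr
        rw [hu]
        exact dg_moll K hK v hV G hG hw η x (hx x hxS)
    _ = ∫⁻ y in K, ∫⁻ x in S,
          ‖deriv f (u x)‖ₑ * (ENNReal.ofReal (ψ (x - y)) * ‖G y‖ₑ) := by
        refine lintegral_lintegral_swap ?_
        have m1 : Continuous fun z : EuclideanSpace ℝ (Fin N) × EuclideanSpace ℝ (Fin N) =>
          ‖deriv f (u z.1)‖ₑ := by fun_prop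
        have m2 : Continuous fun z : EuclideanSpace ℝ (Fin N) × EuclideanSpace ℝ (Fin N) =>
          ENNReal.ofReal (ψ (z.1 - z.2)) := ENNReal.continuous_ofReal.comp (by fun_prop)
        refine AEMeasurable.mul m1.aemeasurable (AEMeasurable.mul m2.aemeasurable ?_)
        exact AEMeasurable.comp_snd (f := fun y => ‖G y‖ₑ) hG.1.enorm
    _ ≤ _ := by
        refine setLIntegral_mono' hK.measurableSet fun y hy => ?_
        calc _ ≤ ∫⁻ x in S, ENNReal.ofReal (ψ (x - y)) *
                (‖G y‖ₑ * (‖deriv f (v y)‖ₑ + δ)) := by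
              refine setLIntegral_mono' hS fun x hxS => ?_
              by_cases hxy : dist x y < η.rOut
              · rw [mul_comm, mul_assoc]
                gcongr
                exact hfu x hxS y hy hxy
              · have : ψ (x - y) = 0 := by
                  by_contra hne
                  have h1 : x - y ∈ Function.support ψ := hne
                  rw [hψ, η.support_normed_eq] at h1
                  apply hxy
                  rw [dist_eq_norm]
                  simpa using h1
                simp [this]
          _ ≤ ∫⁻ x, ENNReal.ofReal (ψ (x - y)) *
                (‖G y‖ₑ * (‖deriv f (v y)‖ₑ + δ)) := setLIntegral_le_lintegral _ _
          _ = _ := by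
              have hmm : Measurable fun x => ENNReal.ofReal (ψ (x - y)) :=
                (ENNReal.continuous_ofReal.comp (f := fun x => ψ (x - y))
                  (by fun_prop)).measurable
              rw [lintegral_mul_const _ hmm,
                lintegral_sub_right_eq_self (fun x => ENNReal.ofReal (ψ x)) y, hψ1, one_mul]

open scoped Convolution in
lemma dg_core {N : ℕ} (K : Set (EuclideanSpace ℝ (Fin N))) (hK : IsOpen K)
    (hKc : IsCompact (closure K))
    (v : EuclideanSpace ℝ (Fin N) → ℝ) (hv : ContinuousOn v (closure K))
    (G : EuclideanSpace ℝ (Fin N) → EuclideanSpace ℝ (Fin N)) (hG : IntegrableOn G K)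
    (hw : ∀ φ : EuclideanSpace ℝ (Fin N) → ℝ, ContDiff ℝ (⊤ : ℕ∞) φ → HasCompactSupport φ →
        tsupport φ ⊆ K → ∀ i : Fin N,
        (∫ x in K, v x * fderiv ℝ φ x (EuclideanSpace.single i 1)) = - ∫ x in K, G x i * φ x)
    (S : Set (EuclideanSpace ℝ (Fin N)))
    (hS : MeasurableSet S) (hconv : Convex ℝ S) (d : ℝ) (hd : ∀ x ∈ S, ∀ y ∈ S, ‖y - x‖ ≤ d)
    (ε₀ : ℝ) (hε₀ : 0 < ε₀)
    (hx : ∀ x ∈ S, Metric.closedBall x ε₀ ⊆ K) (f : ℝ → ℝ) (hf : ContDiff ℝ 1 f)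
    (hfu : UniformContinuous f) (hfu' : UniformContinuous (deriv f)) (k l : ℝ)
    (hfk : ∀ s < k, f s = 0) (hfl : ∀ s, l < s → f s = 1) :
    volume (S ∩ {x | x ∈ K ∧ v x < k}) * volume (S ∩ {x | x ∈ K ∧ l < v x}) ≤
      ENNReal.ofReal d * (2 ^ N * volume K * ∫⁻ y in K, ‖G y‖ₑ * ‖deriv f (v y)‖ₑ) := by
  have hKfin : volume K < ⊤ := (measure_mono subset_closure).trans_lt hKc.measure_lt_top
  have hSK : S ⊆ K := fun x hxS => hx x hxS (Metric.mem_closedBall_self hε₀.le)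
  have hfc : Continuous (deriv f) := hf.continuous_deriv (by norm_num)
  have hvK : ContinuousOn v K := hv.mono subset_closure
  have hVm : Integrable (K.indicator v) :=
    ((hv.integrableOn_compact hKc).mono_set subset_closure).integrable_indicator hK.measurableSet
  set A := S ∩ {x | x ∈ K ∧ v x < k} with hA
  set B := S ∩ {x | x ∈ K ∧ l < v x} with hB
  have hAm : MeasurableSet A := hS.inter (hvK.isOpen_inter_preimage hK isOpen_Iio).measurableSet
  have hBm : MeasurableSet B := hS.inter (hvK.isOpen_inter_preimage hK isOpen_Ioi).measurableSet
  have hAfin : volume A ≠ ⊤ := ((measure_mono (inter_subset_left.trans hSK)).trans_lt hKfin).ne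
  have hBfin : volume B ≠ ⊤ := ((measure_mono (inter_subset_left.trans hSK)).trans_lt hKfin).ne
  have hGfin : ∫⁻ y in K, ‖G y‖ₑ ≠ ⊤ := hG.2.ne
  have main : ∀ δ : ℝ, 0 < δ → ENNReal.ofReal (1 - 2 * δ) * (volume A * volume B) ≤
      ENNReal.ofReal d * (2 ^ N * volume K * ((∫⁻ y in K, ‖G y‖ₑ * ‖deriv f (v y)‖ₑ)
        + ENNReal.ofReal δ * ∫⁻ y in K, ‖G y‖ₑ)) := by
    intro δ hδ
    obtain ⟨τ₁, hτ₁, h1⟩ := Metric.uniformContinuous_iff.1 hfu δ hδ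
    obtain ⟨τ₂, hτ₂, h2⟩ := Metric.uniformContinuous_iff.1 hfu' δ hδ
    set τ := min τ₁ τ₂ with hτdef
    have hτ : 0 < τ := lt_min hτ₁ hτ₂
    obtain ⟨r, hr, h3⟩ := Metric.uniformContinuousOn_iff.1
      (hKc.uniformContinuousOn_of_continuous hv) (τ / 2) (by linarith)
    set ε := min ε₀ r with hε
    have hεpos : 0 < ε := lt_min hε₀ hr
    let η : ContDiffBump (0 : EuclideanSpace ℝ (Fin N)) := ⟨ε / 2, ε, by linarith, by linarith⟩
    have hηr : η.rOut = ε := rfl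
    have hball : ∀ x ∈ S, Metric.closedBall x η.rOut ⊆ K := fun x hxS =>
      (Metric.closedBall_subset_closedBall (min_le_left _ _)).trans (hx x hxS)
    set u := η.normed volume ⋆[ContinuousLinearMap.lsmul ℝ ℝ, volume] K.indicator v with hu
    have huc : ContDiff ℝ 1 u :=
      η.hasCompactSupport_normed.contDiff_convolution_left _ η.contDiff_normed
        hVm.locallyIntegrable
    have huv : ∀ x ∈ S, dist (u x) (v x) ≤ τ / 2 := by
      intro x hxS
      have e : v x = K.indicator v x := by simp [hSK hxS]
      rw [e]
      refine η.dist_normed_convolution_le hVm.1 fun y hy => ?_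
      have hyK : y ∈ K := hball x hxS (Metric.ball_subset_closedBall hy)
      simp only [hyK, hSK hxS, indicator_of_mem]
      exact (h3 y (subset_closure hyK) x (subset_closure (hSK hxS))
        (lt_of_lt_of_le hy (min_le_right _ _))).le
    have huv' : ∀ x ∈ S, ∀ y ∈ K, dist x y < η.rOut → dist (u x) (v y) < τ := by
      intro x hxS y hy hxy
      have := h3 x (subset_closure (hSK hxS)) y (subset_closure hy)
        (lt_of_lt_of_le hxy (min_le_right _ _))
      linarith [dist_triangle (u x) (v x) (v y), huv x hxS]
    have hgr := dg_grad K hK v hVm G hG hw η S hS hball f hf (ENNReal.ofReal δ) u hu huc (by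
      intro x hxS y hy hxy
      have := h2 (lt_of_lt_of_le (huv' x hxS y hy hxy) (min_le_right _ _))
      rw [← ofReal_norm, ← ofReal_norm, ← ENNReal.ofReal_add (norm_nonneg _) hδ.le]
      refine ENNReal.ofReal_le_ofReal ?_
      rw [dist_eq_norm] at this
      linarith [norm_sub_norm_le (deriv f (u x)) (deriv f (v y))])
    have hpo := dg_poin S hS hconv d hd (fun x => f (u x)) (hf.comp huc)
    have hint : ∫⁻ y in K, ‖G y‖ₑ * (‖deriv f (v y)‖ₑ + ENNReal.ofReal δ) =
        (∫⁻ y in K, ‖G y‖ₑ * ‖deriv f (v y)‖ₑ) + ENNReal.ofReal δ * ∫⁻ y in K, ‖G y‖ₑ := by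
      simp_rw [mul_add]
      rw [lintegral_add_right' _ (hG.1.enorm.mul_const _),
        lintegral_mul_const' _ _ ENNReal.ofReal_ne_top, mul_comm (ENNReal.ofReal δ)]
    rw [hint] at hgr
    have hlow : ENNReal.ofReal (1 - 2 * δ) * (volume A * volume B) ≤
        ∫⁻ x in S, ∫⁻ y in S, ‖f (u y) - f (u x)‖ₑ := by
      calc _ = ∫⁻ x in A, ∫⁻ y in B, ENNReal.ofReal (1 - 2 * δ) := by
            simp only [lintegral_const, Measure.restrict_apply_univ]; ring
        _ ≤ ∫⁻ x in A, ∫⁻ y in B, ‖f (u y) - f (u x)‖ₑ := by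
            refine setLIntegral_mono' hAm fun x hxA => setLIntegral_mono' hBm fun y hyB => ?_
            rw [← ofReal_norm]
            refine ENNReal.ofReal_le_ofReal ?_
            have ex := h1 (lt_of_lt_of_le (lt_of_le_of_lt (huv x hxA.1) (half_lt_self hτ))
              (min_le_left _ _))
            have ey := h1 (lt_of_lt_of_le (lt_of_le_of_lt (huv y hyB.1) (half_lt_self hτ))
              (min_le_left _ _))
            rw [hfk _ hxA.2.2, Real.dist_eq, abs_lt] at ex
            rw [hfl _ hyB.2.2, Real.dist_eq, abs_lt] at ey
            rw [Real.norm_eq_abs]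
            refine le_trans ?_ (le_abs_self _)
            linarith [ex.2, ey.1]
        _ ≤ ∫⁻ x in A, ∫⁻ y in S, ‖f (u y) - f (u x)‖ₑ :=
            lintegral_mono fun x => lintegral_mono_set inter_subset_left
        _ ≤ _ := lintegral_mono_set inter_subset_left
    refine hlow.trans (hpo.trans ?_)
    gcongr
  have c1 : Continuous fun δ : ℝ => ENNReal.ofReal (1 - 2 * δ) * (volume A * volume B) :=
    (ENNReal.continuous_mul_const (ENNReal.mul_ne_top hAfin hBfin)).comp
      (ENNReal.continuous_ofReal.comp (by fun_prop))
  have c2 : Continuous fun δ : ℝ => ENNReal.ofReal d * (2 ^ N * volume K *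
      ((∫⁻ y in K, ‖G y‖ₑ * ‖deriv f (v y)‖ₑ) + ENNReal.ofReal δ * ∫⁻ y in K, ‖G y‖ₑ)) := by
    refine (ENNReal.continuous_const_mul ENNReal.ofReal_ne_top).comp
      ((ENNReal.continuous_const_mul (ENNReal.mul_ne_top (by simp) hKfin.ne)).comp
        (continuous_const.add ((ENNReal.continuous_mul_const hGfin).comp
          ENNReal.continuous_ofReal)))
  have := le_of_tendsto_of_tendsto (b := nhdsWithin (0:ℝ) (Ioi 0))
    ((c1.tendsto 0).mono_left nhdsWithin_le_nhds)
    ((c2.tendsto 0).mono_left nhdsWithin_le_nhds)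
    (by filter_upwards [self_mem_nhdsWithin] with δ hδ using main δ hδ)
  simpa using this

lemma dg_cube_open {N : ℕ} (x0 : EuclideanSpace ℝ (Fin N)) (ρ : ℝ) : IsOpen (cube N x0 ρ) := by
  unfold cube
  simp only [ofPred_forall]
  exact isOpen_iInter_of_finite fun i => isOpen_lt (by fun_prop) continuous_const

lemma dg_cube_convex {N : ℕ} (x0 : EuclideanSpace ℝ (Fin N)) (ρ : ℝ) :
    Convex ℝ (cube N x0 ρ) := by
  intro x hx y hy a b ha hb hab i
  have e : (a • x + b • y) i - x0 i = a * (x i - x0 i) + b * (y i - x0 i) := by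
    have : x0 i = (a + b) * x0 i := by rw [hab, one_mul]
    simp only [PiLp.add_apply, PiLp.smul_apply, smul_eq_mul]
    linear_combination -this
  rw [e]
  have h1 := abs_lt.1 (hx i)
  have h2 := abs_lt.1 (hy i)
  have := (convex_Ioo (-ρ) ρ) (show x i - x0 i ∈ Ioo (-ρ) ρ from h1)
    (show y i - x0 i ∈ Ioo (-ρ) ρ from h2) ha hb hab
  exact abs_lt.2 this

lemma dg_cube_diam {N : ℕ} (x0 : EuclideanSpace ℝ (Fin N)) (ρ : ℝ) (hρ : 0 < ρ)
    (x y : EuclideanSpace ℝ (Fin N)) (hx : x ∈ cube N x0 ρ) (hy : y ∈ cube N x0 ρ) :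
    ‖y - x‖ ≤ 2 * ρ * N := by
  rw [EuclideanSpace.norm_eq]
  apply Real.sqrt_le_iff.2
  refine ⟨by positivity, ?_⟩
  calc ∑ i, ‖(y - x) i‖ ^ 2 ≤ ∑ i : Fin N, (2 * ρ) ^ 2 := by
        refine Finset.sum_le_sum fun i _ => ?_
        gcongr
        have h1 := abs_lt.1 (hx i)
        have h2 := abs_lt.1 (hy i)
        rw [Real.norm_eq_abs, PiLp.sub_apply, abs_le]
        constructor <;> linarith [h1.1, h1.2, h2.1, h2.2]
    _ = N * (2 * ρ) ^ 2 := by simp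
    _ ≤ (2 * ρ * N) ^ 2 := by
        have : (N : ℝ) ≤ (N : ℝ) ^ 2 := by exact_mod_cast Nat.le_self_pow (by norm_num) N
        nlinarith [mul_le_mul_of_nonneg_right this (sq_nonneg (2 * ρ))]

lemma dg_cube_vol {N : ℕ} (x0 : EuclideanSpace ℝ (Fin N)) (ρ : ℝ) (hρ : 0 < ρ) :
    volume (cube N x0 ρ) ≤ ENNReal.ofReal ((2 * ρ) ^ N) := by
  have h := (PiLp.volume_preserving_ofLp (Fin N)).measure_preimage
    (s := Metric.ball (x0.ofLp) ρ) Metric.isOpen_ball.measurableSet.nullMeasurableSet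
  rw [Real.volume_pi_ball _ hρ, Fintype.card_fin] at h
  rw [← h]
  refine measure_mono fun x hx => ?_
  rw [mem_preimage, Metric.mem_ball, dist_pi_lt_iff hρ]
  intro i
  rw [Real.dist_eq]
  exact hx i

lemma dg_cube_compact {N : ℕ} (x0 : EuclideanSpace ℝ (Fin N)) (ρ : ℝ) (hρ : 0 < ρ) :
    IsCompact (closure (cube N x0 ρ)) := by
  refine Bornology.IsBounded.isCompact_closure ?_
  refine (Metric.isBounded_iff).2 ⟨2 * ρ * N, fun x hx y hy => ?_⟩
  rw [dist_eq_norm]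
  exact dg_cube_diam x0 ρ hρ y x hy hx

lemma dg_cube_inner {N : ℕ} (x0 : EuclideanSpace ℝ (Fin N)) (ρ ε : ℝ)
    (x : EuclideanSpace ℝ (Fin N)) (hx : x ∈ cube N x0 (ρ - ε)) :
    Metric.closedBall x ε ⊆ cube N x0 ρ := by
  intro z hz i
  have h1 := hx i
  have h2 : ‖(z - x) i‖ ≤ ‖z - x‖ := PiLp.norm_apply_le _ i
  rw [Metric.mem_closedBall, dist_eq_norm] at hz
  rw [Real.norm_eq_abs, PiLp.sub_apply] at h2
  linarith [abs_sub_le (z i) (x i) (x0 i)]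

lemma dg_T : ∃ M : ℝ, 0 ≤ M ∧ ∀ s, |deriv smoothTransition s| ≤ M := by
  have hz : ∀ s, s ∉ Icc (0:ℝ) 1 → deriv smoothTransition s = 0 := by
    intro s hs
    rcases le_or_gt s 0 with h | h
    · refine IsLocalMin.deriv_eq_zero (Filter.Eventually.of_forall fun y => ?_)
      rw [smoothTransition.zero_of_nonpos h]
      exact smoothTransition.nonneg y
    · have h1 : 1 ≤ s := by
        by_contra h1
        exact hs ⟨h.le, (not_le.1 h1).le⟩
      refine IsLocalMax.deriv_eq_zero (Filter.Eventually.of_forall fun y => ?_)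
      rw [smoothTransition.one_of_one_le h1]
      exact smoothTransition.le_one y
  have hc : Continuous (deriv smoothTransition) :=
    (smoothTransition.contDiff (n := 1)).continuous_deriv (by norm_num)
  obtain ⟨C, hC⟩ := (HasCompactSupport.intro isCompact_Icc (fun s hs => hz s hs)
    : HasCompactSupport (deriv smoothTransition)).exists_bound_of_continuous hc
  exact ⟨C, (norm_nonneg _).trans (hC 0), hC⟩

lemma dg_f (M : ℝ) (hM : ∀ s, |deriv smoothTransition s| ≤ M) (k l : ℝ) (hkl : k < l) :
    ∃ f : ℝ → ℝ, ContDiff ℝ 1 f ∧ UniformContinuous f ∧ UniformContinuous (deriv f) ∧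
      (∀ s < k, f s = 0) ∧ (∀ s, l < s → f s = 1) ∧ (∀ s, ‖deriv f s‖ ≤ M / (l - k)) ∧
      (∀ s, ¬ (k < s ∧ s < l) → deriv f s = 0) := by
  have hlk : 0 < l - k := by linarith
  set f : ℝ → ℝ := fun s => smoothTransition ((s - k) / (l - k)) with hf
  have hfc : ContDiff ℝ 1 f := (smoothTransition.contDiff (n := 1)).comp
    ((contDiff_id.sub contDiff_const).div_const _)
  have hk : ∀ s ≤ k, f s = 0 := fun s hs =>
    smoothTransition.zero_of_nonpos (div_nonpos_of_nonpos_of_nonneg (by linarith) hlk.le)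
  have hl : ∀ s, l ≤ s → f s = 1 := fun s hs =>
    smoothTransition.one_of_one_le ((one_le_div hlk).2 (by linarith))
  have hb : ∀ s, ‖deriv f s‖ ≤ M / (l - k) := by
    intro s
    have h1 : HasDerivAt (fun s : ℝ => (s - k) / (l - k)) (1 / (l - k)) s :=
      ((hasDerivAt_id s).sub_const k).div_const _
    have h2 := (((smoothTransition.contDiff (n := 1)).differentiable (by norm_num))
      ((s - k) / (l - k))).hasDerivAt.comp s h1
    have h3 : deriv f s = _ := h2.deriv
    rw [h3, norm_mul, Real.norm_eq_abs, Real.norm_eq_abs, abs_of_pos (by positivity : 0 < 1 / (l-k)),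
      mul_one_div]
    gcongr
    exact hM _
  have hz : ∀ s, ¬ (k < s ∧ s < l) → deriv f s = 0 := by
    intro s hs
    rcases le_or_gt s k with h | h
    · refine IsLocalMin.deriv_eq_zero (Filter.Eventually.of_forall fun y => ?_)
      rw [hk s h]
      exact smoothTransition.nonneg _
    · refine IsLocalMax.deriv_eq_zero (Filter.Eventually.of_forall fun y => ?_)
      rw [hl s (not_lt.1 fun h' => hs ⟨h, h'⟩)]
      exact smoothTransition.le_one _
  refine ⟨f, hfc, ?_, ?_, fun s hs => hk s hs.le, fun s hs => hl s hs.le, hb, hz⟩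
  · have hMn : 0 ≤ M / (l - k) := (norm_nonneg _).trans (hb 0)
    exact (lipschitzWith_of_nnnorm_deriv_le (C := ⟨M / (l - k), hMn⟩)
      (hfc.differentiable (by norm_num)) fun s => hb s).uniformContinuous
  · refine HasCompactSupport.uniformContinuous_of_continuous ?_
      (hfc.continuous_deriv (by norm_num))
    exact HasCompactSupport.intro isCompact_Icc (K := Icc k l)
      fun s hs => hz s fun h => hs ⟨h.1.le, h.2.le⟩

/-- De Giorgi–Poincaré inequality. -/
theorem deGiorgi_poincare (N : ℕ) (hN : 1 ≤ N) :
    ∃ γ : ℝ, 0 < γ ∧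
    ∀ (ρ : ℝ), 0 < ρ → ∀ (x0 : EuclideanSpace ℝ (Fin N))
      (v : EuclideanSpace ℝ (Fin N) → ℝ)
      (Dv : EuclideanSpace ℝ (Fin N) → EuclideanSpace ℝ (Fin N)),
      ContinuousOn v (closure (cube N x0 ρ)) →
      IntegrableOn Dv (cube N x0 ρ) →
      (∀ φ : EuclideanSpace ℝ (Fin N) → ℝ, ContDiff ℝ (⊤ : ℕ∞) φ → HasCompactSupport φ →
        tsupport φ ⊆ cube N x0 ρ → ∀ i : Fin N,
        (∫ x in cube N x0 ρ, v x * fderiv ℝ φ x (EuclideanSpace.single i 1)) =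
          - ∫ x in cube N x0 ρ, Dv x i * φ x) →
      ∀ k l : ℝ, k < l →
      0 < volume {x ∈ cube N x0 ρ | l < v x} →
      (l - k) * (volume {x ∈ cube N x0 ρ | v x < k}).toReal ≤
        γ * ρ ^ (N + 1) * ((volume {x ∈ cube N x0 ρ | l < v x}).toReal)⁻¹ *
          ∫ x in {x ∈ cube N x0 ρ | k < v x ∧ v x < l}, ‖Dv x‖ := by
  obtain ⟨M, hM0, hM⟩ := dg_T
  have hN0 : (0:ℝ) < N := by exact_mod_cast hN
  refine ⟨2 * N * 2 ^ N * 2 ^ N * (M + 1), by positivity, ?_⟩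
  intro ρ hρ x0 v G hv hG hw k l hkl hpos
  have hlk : 0 < l - k := by linarith
  obtain ⟨f, hf, hfu, hfu', hfk, hfl, hfb, hfz⟩ := dg_f M hM k l hkl
  set K := cube N x0 ρ with hKdef
  have hK : IsOpen K := dg_cube_open x0 ρ
  have hKc : IsCompact (closure K) := dg_cube_compact x0 ρ hρ
  have hKfin : volume K < ⊤ := (measure_mono subset_closure).trans_lt hKc.measure_lt_top
  have hvK : ContinuousOn v K := hv.mono subset_closure
  set A := {x | x ∈ K ∧ v x < k} with hA
  set B := {x | x ∈ K ∧ l < v x} with hB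
  set C := {x | x ∈ K ∧ k < v x ∧ v x < l} with hC
  have hCm : MeasurableSet C := (hvK.isOpen_inter_preimage hK isOpen_Ioo).measurableSet
  have hAfin : volume A ≠ ⊤ := ((measure_mono fun x hx => hx.1).trans_lt hKfin).ne
  have hBfin : volume B ≠ ⊤ := ((measure_mono fun x hx => hx.1).trans_lt hKfin).ne
  set R := ENNReal.ofReal (2 * ρ * N) *
    (2 ^ N * volume K * ∫⁻ y in K, ‖G y‖ₑ * ‖deriv f (v y)‖ₑ) with hR
  let S : ℕ → Set (EuclideanSpace ℝ (Fin N)) := fun n => cube N x0 (ρ - 1 / ((n:ℝ) + 1))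
  have hSK : ∀ n, S n ⊆ K := fun n x hx i =>
    (hx i).trans_le (sub_le_self _ (by positivity))
  have hSmono : Monotone S := by
    intro n m hnm x hx i
    refine (hx i).trans_le ?_
    gcongr
  have hSU : ∀ D ⊆ K, ⋃ n, S n ∩ D = D := by
    intro D hD
    refine Subset.antisymm (iUnion_subset fun n => inter_subset_right) fun x hx => ?_
    have hxK : ∀ i, |x i - x0 i| < ρ := hD hx
    have hev : ∀ᶠ n : ℕ in Filter.atTop, ∀ i, |x i - x0 i| < ρ - 1 / ((n:ℝ) + 1) := by
      rw [Filter.eventually_all]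
      intro i
      have ht : Filter.Tendsto (fun n : ℕ => ρ - 1 / ((n:ℝ) + 1)) Filter.atTop (nhds (ρ - 0)) :=
        tendsto_const_nhds.sub tendsto_one_div_add_atTop_nhds_zero_nat
      rw [sub_zero] at ht
      exact ht.eventually (lt_mem_nhds (hxK i))
    obtain ⟨n, hn⟩ := hev.exists
    exact mem_iUnion.2 ⟨n, hn, hx⟩
  have hlim : ∀ D ⊆ K, Filter.Tendsto (fun n => volume (S n ∩ D)) Filter.atTop
      (nhds (volume D)) := by
    intro D hD
    have := tendsto_measure_iUnion_atTop (μ := (volume : Measure (EuclideanSpace ℝ (Fin N))))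
      (s := fun n => S n ∩ D) (fun n m hnm => inter_subset_inter_left _ (hSmono hnm))
    rw [hSU D hD] at this
    exact this
  have hcore : ∀ n, volume (S n ∩ A) * volume (S n ∩ B) ≤ R := fun n =>
    dg_core K hK hKc v hv G hG hw (S n) (dg_cube_open _ _).measurableSet (dg_cube_convex _ _)
      (2 * ρ * N) (fun x hx y hy => dg_cube_diam x0 ρ hρ x y (hSK n hx) (hSK n hy))
      (1 / ((n:ℝ) + 1)) (by positivity) (fun x hx => dg_cube_inner x0 ρ _ x hx) f hf hfu hfu' k l
      hfk hfl
  have hAB : volume A * volume B ≤ R :=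
    le_of_tendsto' (ENNReal.Tendsto.mul (hlim A fun x hx => hx.1) (Or.inr hBfin)
      (hlim B fun x hx => hx.1) (Or.inr hAfin)) hcore
  set I := ∫ x in C, ‖G x‖ with hI
  have hI0 : 0 ≤ I := integral_nonneg fun x => norm_nonneg _
  have hGC : IntegrableOn G C := hG.mono_set fun x hx => hx.1
  have hInt : ∫⁻ y in K, ‖G y‖ₑ * ‖deriv f (v y)‖ₑ ≤ ENNReal.ofReal (M / (l - k) * I) := by
    rw [ENNReal.ofReal_mul (by positivity), hI, ofReal_integral_norm_eq_lintegral_enorm hGC,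
      ← lintegral_const_mul' _ _ ENNReal.ofReal_ne_top, ← lintegral_indicator hCm,
      ← lintegral_indicator hK.measurableSet]
    refine lintegral_mono fun y => ?_
    by_cases hy : y ∈ K
    · by_cases hyC : y ∈ C
      · simp only [hy, hyC, indicator_of_mem]
        rw [mul_comm]
        gcongr
        rw [← ofReal_norm]
        exact ENNReal.ofReal_le_ofReal (hfb _)
      · have : deriv f (v y) = 0 := hfz _ fun h => hyC ⟨hy, h⟩
        rw [indicator_of_mem hy]
        simp [this]
    · simp [hy]
  have hRle : R ≤ ENNReal.ofReal (2 * ρ * N * (2 ^ N * (2 * ρ) ^ N * (M / (l - k) * I))) := by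
    rw [ENNReal.ofReal_mul (p := 2 * ρ * N) (by positivity),
      ENNReal.ofReal_mul (p := 2 ^ N * (2 * ρ) ^ N) (by positivity),
      ENNReal.ofReal_mul (p := 2 ^ N) (by positivity)]
    have e2 : ENNReal.ofReal (2 ^ N) = 2 ^ N := by
      rw [ENNReal.ofReal_pow (by norm_num)]; simp
    rw [hR, e2]
    gcongr
    exact dg_cube_vol x0 ρ hρ
  have hreal : (volume A).toReal * (volume B).toReal ≤
      2 * ρ * N * (2 ^ N * (2 * ρ) ^ N * (M / (l - k) * I)) := by
    rw [← ENNReal.toReal_mul]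
    exact ENNReal.toReal_le_of_le_ofReal (by positivity) (hAB.trans hRle)
  have hBpos : 0 < (volume B).toReal := ENNReal.toReal_pos hpos.ne' hBfin
  have h1 : (l - k) * (volume A).toReal * (volume B).toReal ≤
      2 * N * 2 ^ N * 2 ^ N * M * ρ ^ (N + 1) * I := by
    calc _ = (l - k) * ((volume A).toReal * (volume B).toReal) := by ring
      _ ≤ (l - k) * (2 * ρ * N * (2 ^ N * (2 * ρ) ^ N * (M / (l - k) * I))) := by gcongr
      _ = _ := by rw [mul_pow]; field_simp; ring
  calc (l - k) * (volume A).toReal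
      = (l - k) * (volume A).toReal * (volume B).toReal * (volume B).toReal⁻¹ := by
        field_simp
    _ ≤ 2 * N * 2 ^ N * 2 ^ N * M * ρ ^ (N + 1) * I * (volume B).toReal⁻¹ := by gcongr
    _ ≤ 2 * N * 2 ^ N * 2 ^ N * (M + 1) * ρ ^ (N + 1) * I * (volume B).toReal⁻¹ := by
        gcongr; linarith
    _ = _ := by ring
end

section
/- (Clustering of positivity for W^{1,1} functions) Let N ≥ 1 be an integer and let γ > 0 and α, δ, λ ∈ (0,1) be given. Then there exists η ∈ (0,1), depending only on N, α, δ, γ and λ, with the following property: for every ρ > 0 and every integrable function u on the cube K_ρ = K_ρ^{0} admitting an integrable weak gradient Du on K_ρ (i.e. a locally integrable vector field Du with ∫ u·∂φ/∂x_i dx = −∫ (Du)_i·φ dx for every smooth compactly supported φ and every i), if ∫_{K_ρ} |Du| dx ≤ γ·ρ^{N−1} and meas{x ∈ K_ρ : u(x) > 1} ≥ α·meas(K_ρ), then there exists x0 ∈ K_ρ such that K_{ηρ}^{x0} ⊂ K_ρ and meas{x ∈ K_{ηρ}^{x0} : u(x) > λ} > (1 − δ)·meas(K_{ηρ}^{x0}).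 -/
open Real Set MeasureTheory

open Filter Topology

lemma isOpen_cube (N : ℕ) (y : EuclideanSpace ℝ (Fin N)) (ρ : ℝ) : IsOpen (cube N y ρ) := by
  have : cube N y ρ = ⋂ i, {x | |x i - y i| < ρ} := by ext; simp [cube]
  rw [this]
  refine isOpen_iInter_of_finite fun i => isOpen_lt (by fun_prop) (by fun_prop)

lemma volume_cube (N : ℕ) (y : EuclideanSpace ℝ (Fin N)) (ρ : ℝ) :
    volume (cube N y ρ) = ENNReal.ofReal (2 * ρ) ^ N := by
  have : cube N y ρ = (@WithLp.ofLp 2 (Fin N → ℝ)) ⁻¹'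
      (Set.univ.pi fun i => Set.Ioo (y i - ρ) (y i + ρ)) := by
    ext x
    simp only [cube, Set.mem_ofPred_eq, Set.mem_preimage, Set.mem_univ_pi, Set.mem_Ioo, abs_lt]
    refine forall_congr' fun i => ⟨fun h => ⟨by linarith, by linarith⟩, fun h => ⟨by linarith, by linarith⟩⟩
  rw [this, (PiLp.volume_preserving_ofLp (Fin N)).measure_preimage
    (MeasurableSet.univ_pi fun i => measurableSet_Ioo).nullMeasurableSet, volume_pi_pi]
  have e : ∀ i, y i + ρ - (y i - ρ) = 2 * ρ := fun i => by ring
  simp only [Real.volume_Ioo, e, Finset.prod_const, Finset.card_univ, Fintype.card_fin]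

lemma shift_test (N : ℕ) (ρ s : ℝ)
    (u : EuclideanSpace ℝ (Fin N) → ℝ) (Du : EuclideanSpace ℝ (Fin N) → EuclideanSpace ℝ (Fin N))
    (hu : Integrable u) (hu0 : ∀ x ∉ cube N 0 ρ, u x = 0)
    (hDu : IntegrableOn Du (cube N 0 ρ))
    (hw : ∀ φ : EuclideanSpace ℝ (Fin N) → ℝ, ContDiff ℝ (⊤ : ℕ∞) φ → HasCompactSupport φ →
        tsupport φ ⊆ cube N 0 ρ → ∀ i : Fin N,
        (∫ x in cube N 0 ρ, u x * fderiv ℝ φ x (EuclideanSpace.single i 1)) =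
          - ∫ x in cube N 0 ρ, Du x i * φ x)
    (φ : EuclideanSpace ℝ (Fin N) → ℝ) (hφ : ContDiff ℝ (⊤ : ℕ∞) φ) (hφc : HasCompactSupport φ)
    (hφs : tsupport φ ⊆ cube N 0 (ρ - s)) (hφ1 : ∀ x, |φ x| ≤ 1)
    (h : EuclideanSpace ℝ (Fin N)) (hh : ∀ i, |h i| ≤ s) :
    |(∫ x, u x * φ (x - h)) - ∫ x, u x * φ x| ≤ ‖h‖ * ∫ x in cube N 0 ρ, ‖Du x‖ := by
  set K := cube N 0 ρ with hK
  let g : EuclideanSpace ℝ (Fin N) → ℝ := fun z => φ (-z)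
  have hg : ContDiff ℝ 1 g := (hφ.of_le (by exact_mod_cast le_top)).comp contDiff_neg
  have hgc : HasCompactSupport g := hφc.comp_homeomorph (Homeomorph.neg _)
  let L := ContinuousLinearMap.mul ℝ ℝ
  -- translates
  have key : ∀ t ∈ Set.Icc (0:ℝ) 1,
      ‖∫ x, u x * fderiv ℝ g (t • h - x) h‖ ≤ ‖h‖ * ∫ x in K, ‖Du x‖ := by
    intro t ht
    let ψ : EuclideanSpace ℝ (Fin N) → ℝ := fun x => φ (x - t • h)
    have hψ : ContDiff ℝ (⊤ : ℕ∞) ψ := hφ.comp (contDiff_id.sub contDiff_const)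
    have hψc : HasCompactSupport ψ := hφc.comp_homeomorph (Homeomorph.subRight (t • h))
    have hψs : tsupport ψ ⊆ K := by
      have e : tsupport ψ ⊆ (fun x => x - t • h) ⁻¹' tsupport φ :=
        tsupport_comp_subset_preimage φ (by fun_prop)
      intro x hx i
      have h1 := hφs (e hx) i
      have h2 := hh i
      simp only [PiLp.sub_apply, PiLp.smul_apply, smul_eq_mul, PiLp.zero_apply, sub_zero] at h1 ⊢
      have h3 : |t * h i| ≤ s := by
        rw [abs_mul, abs_of_nonneg ht.1]
        exact (mul_le_of_le_one_left (abs_nonneg _) ht.2).trans h2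
      calc |x i| = |(x i - t * h i) + t * h i| := by ring_nf
        _ ≤ _ := abs_add_le _ _
        _ < ρ := by linarith
    have hfd : ∀ x, fderiv ℝ g (t • h - x) h = - fderiv ℝ ψ x h := by
      intro x
      have hd : DifferentiableAt ℝ φ (x - t • h) := hφ.differentiable (by simp) _
      have hd' : HasFDerivAt φ (fderiv ℝ φ (x - t • h)) (-(t • h - x)) := by
        rw [neg_sub]; exact hd.hasFDerivAt
      have e1 : HasFDerivAt g ((fderiv ℝ φ (x - t • h)).comp (-ContinuousLinearMap.id ℝ _)) (t • h - x) :=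
        hd'.comp (t • h - x) (hasFDerivAt_id (𝕜 := ℝ) _).neg
      have e2 : HasFDerivAt ψ ((fderiv ℝ φ (x - t • h)).comp (ContinuousLinearMap.id ℝ _)) x :=
        hd.hasFDerivAt.comp x ((hasFDerivAt_id (𝕜 := ℝ) x).sub_const (t • h))
      rw [e1.fderiv, e2.fderiv]; simp
    have hsum : ∀ x, fderiv ℝ ψ x h = ∑ i, h i * fderiv ℝ ψ x (EuclideanSpace.single i 1) := by
      intro x
      have : h = ∑ i, h i • EuclideanSpace.single i (1:ℝ) := by
        ext j; simp [Finset.sum_apply, Pi.single_apply]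
      conv_lhs => rw [this]
      simp [map_sum]
    have hDc : ∀ v, Continuous fun x => fderiv ℝ ψ x v := fun v =>
      (hψ.continuous_fderiv (by simp)).clm_apply continuous_const
    have hDcs : ∀ v, HasCompactSupport fun x => fderiv ℝ ψ x v := fun v => hψc.fderiv_apply ℝ v
    have hi1 : ∀ v, Integrable (fun x => u x * fderiv ℝ ψ x v) := by
      intro v
      obtain ⟨C, hC⟩ := (hDcs v).exists_bound_of_continuous (hDc v)
      exact hu.mul_bdd (c := C) (hDc v).aestronglyMeasurable (Eventually.of_forall hC)
    have hDui : ∀ i, Integrable (fun x => Du x i) (volume.restrict K) := fun i =>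
      (EuclideanSpace.proj (𝕜 := ℝ) i).integrable_comp hDu
    have hi2 : ∀ i, Integrable (fun x => Du x i * ψ x) (volume.restrict K) := by
      intro i
      exact (hDui i).mul_bdd (c := 1) hψ.continuous.aestronglyMeasurable
        (Eventually.of_forall fun x => hφ1 _)
    have e : ∫ x, u x * fderiv ℝ g (t • h - x) h = ∫ x in K, inner ℝ (Du x) h * ψ x := by
      calc ∫ x, u x * fderiv ℝ g (t • h - x) h
          = ∫ x in K, u x * fderiv ℝ g (t • h - x) h := by
            rw [setIntegral_eq_integral_of_forall_compl_eq_zero]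
            intro x hx; rw [hu0 x hx, zero_mul]
        _ = ∫ x in K, ∑ i, (-h i) * (u x * fderiv ℝ ψ x (EuclideanSpace.single i 1)) := by
            congr 1; ext x; rw [hfd, hsum, ← Finset.sum_neg_distrib, Finset.mul_sum]
            refine Finset.sum_congr rfl fun i _ => by ring
        _ = ∑ i, ∫ x in K, h i * (Du x i * ψ x) := by
            rw [integral_finsetSum _ fun i _ => ((hi1 _).restrict.const_mul _)]
            refine Finset.sum_congr rfl fun i _ => ?_
            rw [integral_const_mul, integral_const_mul, hw ψ hψ hψc hψs i]; ring
        _ = ∫ x in K, inner ℝ (Du x) h * ψ x := by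
            rw [← integral_finsetSum _ fun i _ => ((hi2 i).const_mul _)]
            congr 1; ext x
            rw [PiLp.inner_apply, Finset.sum_mul]
            refine Finset.sum_congr rfl fun i _ => ?_
            simp; ring
    rw [e, ← integral_const_mul]
    refine norm_integral_le_of_norm_le (hDu.norm.const_mul _) (Eventually.of_forall fun x => ?_)
    rw [norm_mul]
    calc _ ≤ (‖Du x‖ * ‖h‖) * 1 := by
            gcongr
            · exact norm_inner_le_norm _ _
            · exact hφ1 _
      _ = _ := by ring
  have hder : ∀ t : ℝ, HasDerivAt (fun t : ℝ => ∫ x, u x * φ (x - t • h))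
      (∫ x, u x * fderiv ℝ g (t • h - x) h) t := by
    intro t
    have h1 := hgc.hasFDerivAt_convolution_right L hu.locallyIntegrable hg (t • h)
    have h2 : HasDerivAt (fun t : ℝ => t • h) h t := by
      simpa using (hasDerivAt_id t).smul_const h
    have h3 := h1.comp_hasDerivAt t h2
    rw [convolution_precompR_apply L hu.locallyIntegrable (hgc.fderiv ℝ)
      (hg.continuous_fderiv one_ne_zero)] at h3
    have hfun : (fun t : ℝ => ∫ x, u x * φ (x - t • h)) =
        (convolution u g L volume) ∘ (fun t : ℝ => t • h) := by
      ext t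
      simp [convolution, g, L]
    rw [hfun]
    exact h3
  have := norm_image_sub_le_of_norm_deriv_le_segment_01'
    (fun t _ => (hder t).hasDerivWithinAt) (fun t ht => key t ⟨ht.1, ht.2.le⟩)
  simpa using this

lemma shift_compact (N : ℕ) (ρ s : ℝ)
    (u : EuclideanSpace ℝ (Fin N) → ℝ) (Du : EuclideanSpace ℝ (Fin N) → EuclideanSpace ℝ (Fin N))
    (hu : Integrable u) (hu0 : ∀ x ∉ cube N 0 ρ, u x = 0)
    (hDu : IntegrableOn Du (cube N 0 ρ))
    (hw : ∀ φ : EuclideanSpace ℝ (Fin N) → ℝ, ContDiff ℝ (⊤ : ℕ∞) φ → HasCompactSupport φ →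
        tsupport φ ⊆ cube N 0 ρ → ∀ i : Fin N,
        (∫ x in cube N 0 ρ, u x * fderiv ℝ φ x (EuclideanSpace.single i 1)) =
          - ∫ x in cube N 0 ρ, Du x i * φ x)
    (C : Set (EuclideanSpace ℝ (Fin N))) (hC : IsCompact C) (hCs : C ⊆ cube N 0 (ρ - s))
    (h : EuclideanSpace ℝ (Fin N)) (hh : ∀ i, |h i| ≤ s) :
    ∫ x in C, (u x - u (x + h)) ≤ ‖h‖ * ∫ x in cube N 0 ρ, ‖Du x‖ := by
  have hτ : Integrable (fun x => u (x + h)) := hu.comp_add_right h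
  set f : EuclideanSpace ℝ (Fin N) → ℝ := fun x => u x - u (x + h) with hf_def
  have hf : Integrable f := hu.sub hτ
  obtain ⟨δ', δ'pos, hδ'⟩ := hC.exists_cthickening_subset_open (isOpen_cube N 0 (ρ - s)) hCs
  obtain ⟨δ'', δ''pos, hδ''⟩ : ∃ δ, 0 < δ ∧ IsCompact (Metric.cthickening δ C) :=
    hC.exists_isCompact_cthickening
  obtain ⟨v, -, v_pos, v_lim⟩ : ∃ v : ℕ → ℝ, StrictAnti v ∧ (∀ (n : ℕ), v n ∈ Ioo 0 (min δ' δ''))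
    ∧ Tendsto v atTop (𝓝 0) := exists_seq_strictAnti_tendsto' (lt_min δ'pos δ''pos)
  have : ∀ n, ∃ (g : EuclideanSpace ℝ (Fin N) → ℝ), Function.support g = Metric.thickening (v n) C ∧
      ContDiff ℝ (⊤ : ℕ∞) g ∧ Set.range g ⊆ Set.Icc 0 1 ∧ ∀ x ∈ C, g x = 1 := by
    intro n
    rcases exists_contMDiff_support_eq_eq_one_iff (n := (⊤ : ℕ∞))
      (modelWithCornersSelf ℝ (EuclideanSpace ℝ (Fin N)))
      Metric.isOpen_thickening hC.isClosed
      (Metric.self_subset_thickening (v_pos n).1 C) with ⟨g, g_smooth, g_range, g_supp, hg⟩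
    exact ⟨g, g_supp, g_smooth.contDiff, g_range, fun x hx ↦ (hg x).1 hx⟩
  choose g g_supp g_diff g_range hg using this
  have g_abs : ∀ n x, |g n x| ≤ 1 := fun n x => by
    have := g_range n (mem_range_self (f := g n) x)
    rw [abs_of_nonneg this.1]; exact this.2
  have L : Tendsto (fun n ↦ ∫ x, g n x * f x) atTop (𝓝 (∫ x in C, f x)) := by
    rw [← integral_indicator hC.measurableSet]
    refine tendsto_integral_of_dominated_convergence (fun x => ‖f x‖)
      (fun n => (g_diff n).continuous.aestronglyMeasurable.mul hf.aestronglyMeasurable) hf.norm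
      (fun n => Eventually.of_forall fun x => ?_) (Eventually.of_forall fun x => ?_)
    · rw [norm_mul]
      exact mul_le_of_le_one_left (norm_nonneg _) (g_abs n x)
    · by_cases hxs : x ∈ C
      · simp [hg _ x hxs, indicator_of_mem hxs f]
      · simp_rw [indicator_of_notMem hxs f]
        apply tendsto_const_nhds.congr'
        suffices H : ∀ᶠ n in atTop, g n x = 0 by
          filter_upwards [H] with n hn using by simp [hn]
        obtain ⟨ε, εpos, hε⟩ : ∃ ε, 0 < ε ∧ x ∉ Metric.thickening ε C := by
          rw [← hC.isClosed.closure_eq, Metric.closure_eq_iInter_thickening C] at hxs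
          simpa using hxs
        filter_upwards [(tendsto_order.1 v_lim).2 _ εpos] with n hn
        rw [← Function.notMem_support, g_supp]
        contrapose hε
        exact Metric.thickening_mono hn.le C hε
  refine le_of_tendsto L (Eventually.of_forall fun n => ?_)
  have hts : tsupport (g n) ⊆ Metric.cthickening (v n) C := by
    rw [tsupport, g_supp]; exact Metric.closure_thickening_subset_cthickening _ _
  have hcs : HasCompactSupport (g n) := hδ''.of_isClosed_subset (isClosed_tsupport _)
    (hts.trans (Metric.cthickening_mono ((v_pos n).2.le.trans (min_le_right _ _)) _))
  have hsub : tsupport (g n) ⊆ cube N 0 (ρ - s) :=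
    (hts.trans (Metric.cthickening_mono ((v_pos n).2.le.trans (min_le_left _ _)) _)).trans hδ'
  have key := shift_test N ρ s u Du hu hu0 hDu hw (g n) (g_diff n) hcs hsub (g_abs n) h hh
  have e : ∫ x, g n x * f x = (∫ x, u x * g n x) - ∫ x, u x * g n (x - h) := by
    have e1 : ∫ x, u x * g n (x - h) = ∫ x, u (x + h) * g n x := by
      rw [← integral_add_right_eq_self _ h]; simp
    rw [e1, ← integral_sub]
    · congr 1; ext x; simp only [hf_def]; ring
    · exact hu.mul_bdd (c := 1) (g_diff n).continuous.aestronglyMeasurable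
        (Eventually.of_forall (g_abs n))
    · exact hτ.mul_bdd (c := 1) (g_diff n).continuous.aestronglyMeasurable
        (Eventually.of_forall (g_abs n))
  rw [e]
  rw [abs_sub_comm] at key
  exact (le_abs_self _).trans key

lemma shift_meas (N : ℕ) (ρ s lam : ℝ) (hlam : lam < 1)
    (u : EuclideanSpace ℝ (Fin N) → ℝ) (Du : EuclideanSpace ℝ (Fin N) → EuclideanSpace ℝ (Fin N))
    (hu : Integrable u) (hu0 : ∀ x ∉ cube N 0 ρ, u x = 0)
    (hDu : IntegrableOn Du (cube N 0 ρ))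
    (hw : ∀ φ : EuclideanSpace ℝ (Fin N) → ℝ, ContDiff ℝ (⊤ : ℕ∞) φ → HasCompactSupport φ →
        tsupport φ ⊆ cube N 0 ρ → ∀ i : Fin N,
        (∫ x in cube N 0 ρ, u x * fderiv ℝ φ x (EuclideanSpace.single i 1)) =
          - ∫ x in cube N 0 ρ, Du x i * φ x)
    (E : Set (EuclideanSpace ℝ (Fin N))) (hE : MeasurableSet E) (hEs : E ⊆ cube N 0 (ρ - s))
    (h : EuclideanSpace ℝ (Fin N)) (hh : ∀ i, |h i| ≤ s)
    (hE1 : ∀ x ∈ E, 1 < u x) (hE2 : ∀ x ∈ E, u (x + h) ≤ lam) :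
    volume E ≤ ENNReal.ofReal ((‖h‖ * ∫ x in cube N 0 ρ, ‖Du x‖) / (1 - lam)) := by
  rw [hE.measure_eq_iSup_isCompact]
  refine iSup₂_le fun C hCE => iSup_le fun hC => ?_
  have key := shift_compact N ρ s u Du hu hu0 hDu hw C hC (hCE.trans hEs) h hh
  have hfin : volume C ≠ ⊤ := hC.measure_ne_top
  have low : (1 - lam) * volume.real C ≤ ∫ x in C, (u x - u (x + h)) := by
    have := setIntegral_mono_on (μ := volume) (s := C) (f := fun _ => 1 - lam)
      (g := fun x => u x - u (x + h)) (by simp [integrableOn_const_iff, hfin.lt_top])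
      (hu.sub (hu.comp_add_right h)).integrableOn hC.measurableSet
      (fun x hx => by linarith [hE1 x (hCE hx), hE2 x (hCE hx)])
    rw [setIntegral_const, smul_eq_mul, mul_comm] at this
    exact this
  rw [← ENNReal.ofReal_toReal hfin]
  apply ENNReal.ofReal_le_ofReal
  rw [le_div_iff₀ (by linarith), mul_comm]
  exact low.trans key

lemma cube_subset (N : ℕ) (ρ s : ℝ) (x : EuclideanSpace ℝ (Fin N)) (hx : x ∈ cube N 0 (ρ - s)) :
    cube N x s ⊆ cube N 0 ρ := by
  intro y hy i
  have h1 := hx i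
  have h2 := hy i
  simp only [PiLp.zero_apply, sub_zero] at h1 ⊢
  calc |y i| = |(y i - x i) + x i| := by ring_nf
    _ ≤ _ := abs_add_le _ _
    _ < ρ := by linarith

lemma norm_le_of_cube (N : ℕ) (s : ℝ) (h : EuclideanSpace ℝ (Fin N)) (hs : ∀ i, |h i| ≤ s) :
    ‖h‖ ≤ N * s := by
  have : h = ∑ i, h i • EuclideanSpace.single i (1:ℝ) := by
    ext j; simp [Finset.sum_apply, Pi.single_apply]
  rw [this]
  refine (norm_sum_le _ _).trans ?_
  calc _ ≤ ∑ i : Fin N, s := Finset.sum_le_sum fun i _ => by simpa [norm_smul] using hs i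
    _ = N * s := by simp

lemma core (N : ℕ) (hN : 1 ≤ N) (γ α δ lam η : ℝ) (hγ : 0 < γ) (hα : α ∈ Set.Ioo (0:ℝ) 1)
    (hδ : δ ∈ Set.Ioo (0:ℝ) 1) (hlam : lam ∈ Set.Ioo (0:ℝ) 1) (hη0 : 0 < η) (hη1 : η < 1)
    (hηa : N * η ≤ α / 2) (hηb : N * η * γ / (1 - lam) ≤ δ * α / 4)
    (ρ : ℝ) (hρ : 0 < ρ)
    (u : EuclideanSpace ℝ (Fin N) → ℝ) (Du : EuclideanSpace ℝ (Fin N) → EuclideanSpace ℝ (Fin N))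
    (hum : Measurable u)
    (hu : Integrable u) (hu0 : ∀ x ∉ cube N 0 ρ, u x = 0)
    (hDu : IntegrableOn Du (cube N 0 ρ))
    (hw : ∀ φ : EuclideanSpace ℝ (Fin N) → ℝ, ContDiff ℝ (⊤ : ℕ∞) φ → HasCompactSupport φ →
        tsupport φ ⊆ cube N 0 ρ → ∀ i : Fin N,
        (∫ x in cube N 0 ρ, u x * fderiv ℝ φ x (EuclideanSpace.single i 1)) =
          - ∫ x in cube N 0 ρ, Du x i * φ x)
    (hD : (∫ x in cube N 0 ρ, ‖Du x‖) ≤ γ * ρ ^ (N - 1))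
    (hA : ENNReal.ofReal α * volume (cube N 0 ρ) ≤ volume {x ∈ cube N 0 ρ | 1 < u x}) :
    ∃ x0 : EuclideanSpace ℝ (Fin N), cube N x0 (η * ρ) ⊆ cube N 0 ρ ∧
        ENNReal.ofReal (1 - δ) * volume (cube N x0 (η * ρ)) <
          volume {x ∈ cube N x0 (η * ρ) | lam < u x} := by
  by_contra hcon
  push Not at hcon
  have hl : 0 < 1 - lam := by linarith [hlam.2]
  set s := η * ρ with hs
  have hs0 : 0 < s := mul_pos hη0 hρ
  set V := ENNReal.ofReal (2 * s) ^ N with hV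
  have hV0 : V ≠ 0 := pow_ne_zero _ (by simpa using hs0)
  have hVt : V ≠ ⊤ := ENNReal.pow_ne_top ENNReal.ofReal_ne_top
  set A := {x ∈ cube N 0 (ρ - s) | 1 < u x} with hAdef
  have hAm : MeasurableSet A :=
    (isOpen_cube N 0 (ρ - s)).measurableSet.inter (measurableSet_lt measurable_const hum)
  set d := N * η * γ / (1 - lam) * ρ ^ N with hd
  have hρN : ρ * ρ ^ (N - 1) = ρ ^ N := by
    rw [← pow_succ', Nat.sub_add_cancel hN]
  -- sections
  have low : ∀ x ∈ cube N 0 (ρ - s),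
      ENNReal.ofReal δ * V ≤ volume {h ∈ cube N 0 s | u (x + h) ≤ lam} := by
    intro x hx
    have h1 := hcon x (cube_subset N ρ s x hx)
    have e : {h ∈ cube N 0 s | u (x + h) ≤ lam} =
        (fun h => x + h) ⁻¹' {y ∈ cube N x s | u y ≤ lam} := by
      ext h; simp [cube]
    rw [e, measure_preimage_add]
    rw [volume_cube, ← hV] at h1
    have h2 : V ≤ volume {y ∈ cube N x s | lam < u y} + volume {y ∈ cube N x s | u y ≤ lam} := by
      rw [hV, ← volume_cube N x s]
      refine (measure_mono fun y hy => ?_).trans (measure_union_le _ _)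
      rcases lt_or_ge lam (u y) with h | h
      · exact Or.inl ⟨hy, h⟩
      · exact Or.inr ⟨hy, h⟩
    have h3 : V = ENNReal.ofReal (1 - δ) * V + ENNReal.ofReal δ * V := by
      rw [← add_mul, ← ENNReal.ofReal_add (by linarith [hδ.2]) hδ.1.le]; simp
    have h4 : ENNReal.ofReal (1 - δ) * V + ENNReal.ofReal δ * V ≤
        ENNReal.ofReal (1 - δ) * V + volume {y ∈ cube N x s | u y ≤ lam} := by
      rw [← h3]; exact h2.trans (by gcongr)
    exact (ENNReal.add_le_add_iff_left (ENNReal.mul_ne_top ENNReal.ofReal_ne_top hVt)).1 h4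
  have up : ∀ h ∈ cube N 0 s, volume {x ∈ A | u (x + h) ≤ lam} ≤ ENNReal.ofReal d := by
    intro h hh
    have hh' : ∀ i, |h i| ≤ s := fun i => by have := (hh i).le; simpa using this
    refine (shift_meas N ρ s lam hlam.2 u Du hu hu0 hDu hw {x ∈ A | u (x + h) ≤ lam}
      (hAm.inter (measurableSet_le (hum.comp (measurable_id.add_const h)) measurable_const))
      (fun x hx => hx.1.1) h hh' (fun x hx => hx.1.2) (fun x hx => hx.2)).trans ?_
    apply ENNReal.ofReal_le_ofReal
    have : ‖h‖ * ∫ x in cube N 0 ρ, ‖Du x‖ ≤ (N * s) * (γ * ρ ^ (N - 1)) :=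
      mul_le_mul (norm_le_of_cube N s h hh') hD (integral_nonneg fun x => norm_nonneg _) (by positivity)
    calc _ ≤ ((N * s) * (γ * ρ ^ (N - 1))) / (1 - lam) := by gcongr
      _ = d := by rw [hd, ← hρN, hs]; ring
  -- Tonelli
  let T : Set (EuclideanSpace ℝ (Fin N) × EuclideanSpace ℝ (Fin N)) :=
    {p | p.1 ∈ A ∧ p.2 ∈ cube N 0 s ∧ u (p.1 + p.2) ≤ lam}
  have hT : MeasurableSet T :=
    (measurable_fst hAm).inter ((measurable_snd (isOpen_cube N 0 s).measurableSet).inter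
      (measurableSet_le (hum.comp (measurable_fst.add measurable_snd)) measurable_const))
  have t1 : (volume.prod volume) T ≤ ENNReal.ofReal d * V := by
    rw [Measure.prod_apply_symm hT]
    calc _ ≤ ∫⁻ h, (cube N 0 s).indicator (fun _ => ENNReal.ofReal d) h := by
          refine lintegral_mono fun h => ?_
          by_cases hh : h ∈ cube N 0 s
          · rw [indicator_of_mem hh]
            have hsub : (fun x => (x, h)) ⁻¹' T ⊆ {x ∈ A | u (x + h) ≤ lam} :=
              fun x hx => ⟨hx.1, hx.2.2⟩
            exact le_trans (measure_mono hsub) (up h hh)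
          · rw [indicator_of_notMem hh]
            have : (fun x => (x, h)) ⁻¹' T = ∅ := by
              ext x; simp [T, hh]
            rw [this]; simp
      _ = _ := by
          rw [lintegral_indicator_const (isOpen_cube N 0 s).measurableSet, volume_cube]
  have t2 : ENNReal.ofReal δ * V * volume A ≤ (volume.prod volume) T := by
    rw [Measure.prod_apply hT]
    calc _ = ∫⁻ x, A.indicator (fun _ => ENNReal.ofReal δ * V) x := by
          rw [lintegral_indicator_const hAm]
      _ ≤ _ := by
          refine lintegral_mono fun x => ?_
          by_cases hx : x ∈ A
          · rw [indicator_of_mem hx]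
            refine (low x hx.1).trans (measure_mono fun h hh => ⟨hx, hh⟩)
          · rw [indicator_of_notMem hx]; exact zero_le
  have t3 : ENNReal.ofReal δ * volume A ≤ ENNReal.ofReal d := by
    have := t2.trans t1
    rw [mul_right_comm] at this
    exact (ENNReal.mul_le_mul_iff_left hV0 hVt).1 this
  -- lower bound of A
  have hsρ : ρ - s = (1 - η) * ρ := by rw [hs]; ring
  have hr : 0 ≤ ρ - s := by rw [hsρ]; exact mul_nonneg (by linarith) hρ.le
  have a1 : ENNReal.ofReal (α * (2 * ρ) ^ N) ≤
      volume A + ENNReal.ofReal ((2 * ρ) ^ N - (2 * (ρ - s)) ^ N) := by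
    rw [volume_cube, ← ENNReal.ofReal_pow (by positivity), ← ENNReal.ofReal_mul hα.1.le] at hA
    refine hA.trans ?_
    have hsub : cube N 0 (ρ - s) ⊆ cube N 0 ρ := fun x hx i => (hx i).trans (by linarith)
    have hdiff : volume (cube N 0 ρ \ cube N 0 (ρ - s)) =
        ENNReal.ofReal ((2 * ρ) ^ N - (2 * (ρ - s)) ^ N) := by
      rw [measure_sdiff hsub (isOpen_cube _ _ _).measurableSet.nullMeasurableSet
        (by rw [volume_cube]; exact ENNReal.pow_ne_top ENNReal.ofReal_ne_top),
        volume_cube, volume_cube, ENNReal.ofReal_sub _ (by positivity),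
        ENNReal.ofReal_pow (by positivity), ENNReal.ofReal_pow (by positivity)]
    rw [← hdiff]
    refine (measure_mono fun x hx => ?_).trans (measure_union_le _ _)
    by_cases h : x ∈ cube N 0 (ρ - s)
    · exact Or.inl ⟨h, hx.2⟩
    · exact Or.inr ⟨hx.1, h⟩
  have bern : (1 - α / 2) * (2 * ρ) ^ N ≤ (2 * (ρ - s)) ^ N := by
    have b1 : 1 + (N:ℝ) * (-η) ≤ (1 + (-η)) ^ N := one_add_mul_le_pow (by linarith) N
    have : (2 * (ρ - s)) ^ N = (1 + (-η)) ^ N * (2 * ρ) ^ N := by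
      rw [hsρ, ← mul_pow]; ring
    rw [this]
    gcongr
    linarith
  have hAfin : volume A ≠ ⊤ := by
    refine ne_top_of_le_ne_top ?_ (measure_mono (t := cube N 0 (ρ - s)) fun x hx => hx.1)
    rw [volume_cube]; exact ENNReal.pow_ne_top ENNReal.ofReal_ne_top
  have hd0 : 0 ≤ d := by positivity
  have hdiff0 : 0 ≤ (2 * ρ) ^ N - (2 * (ρ - s)) ^ N := by
    rw [sub_nonneg]; gcongr; linarith
  rw [← ENNReal.ofReal_toReal hAfin] at a1 t3
  rw [← ENNReal.ofReal_add ENNReal.toReal_nonneg hdiff0,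
    ENNReal.ofReal_le_ofReal_iff (by positivity)] at a1
  rw [← ENNReal.ofReal_mul hδ.1.le, ENNReal.ofReal_le_ofReal_iff hd0] at t3
  have a2 : α / 2 * (2 * ρ) ^ N ≤ (volume A).toReal := by linarith
  have h2N : ρ ^ N ≤ (2 * ρ) ^ N := by gcongr; linarith
  have hρN0 : 0 < ρ ^ N := by positivity
  have c1 : d ≤ δ * α / 4 * ρ ^ N := by rw [hd]; gcongr
  have c2 : δ * (α / 2 * ρ ^ N) ≤ δ * (volume A).toReal := by
    have := hδ.1; have := hα.1
    gcongr
    exact le_trans (by gcongr) a2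
  have c3 : 0 < δ * α * ρ ^ N := mul_pos (mul_pos hδ.1 hα.1) hρN0
  nlinarith

/-- Clustering of positivity for `W^{1,1}` functions. -/
theorem clustering_of_positivity (N : ℕ) (hN : 1 ≤ N)
    (γ α δ lam : ℝ) (hγ : 0 < γ) (hα : α ∈ Set.Ioo (0:ℝ) 1)
    (hδ : δ ∈ Set.Ioo (0:ℝ) 1) (hlam : lam ∈ Set.Ioo (0:ℝ) 1) :
    ∃ η ∈ Set.Ioo (0:ℝ) 1,
    ∀ (ρ : ℝ), 0 < ρ →
    ∀ (u : EuclideanSpace ℝ (Fin N) → ℝ)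
      (Du : EuclideanSpace ℝ (Fin N) → EuclideanSpace ℝ (Fin N)),
      IntegrableOn u (cube N 0 ρ) →
      IntegrableOn Du (cube N 0 ρ) →
      (∀ φ : EuclideanSpace ℝ (Fin N) → ℝ, ContDiff ℝ (⊤ : ℕ∞) φ → HasCompactSupport φ →
        tsupport φ ⊆ cube N 0 ρ → ∀ i : Fin N,
        (∫ x in cube N 0 ρ, u x * fderiv ℝ φ x (EuclideanSpace.single i 1)) =
          - ∫ x in cube N 0 ρ, Du x i * φ x) →
      (∫ x in cube N 0 ρ, ‖Du x‖) ≤ γ * ρ ^ (N - 1) →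
      ENNReal.ofReal α * volume (cube N 0 ρ) ≤ volume {x ∈ cube N 0 ρ | 1 < u x} →
      ∃ x0 : EuclideanSpace ℝ (Fin N), cube N x0 (η * ρ) ⊆ cube N 0 ρ ∧
        ENNReal.ofReal (1 - δ) * volume (cube N x0 (η * ρ)) <
          volume {x ∈ cube N x0 (η * ρ) | lam < u x} := by
  have hN0 : (0:ℝ) < N := by exact_mod_cast hN
  have hN1 : (1:ℝ) ≤ N := by exact_mod_cast hN
  have hl : 0 < 1 - lam := by linarith [hlam.2]
  have hα0 := hα.1
  have hδ0 := hδ.1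
  set η := min (α / (2 * N)) (δ * α * (1 - lam) / (4 * N * γ)) with hη
  have hη0 : 0 < η := lt_min (by positivity) (by positivity)
  have hηa : N * η ≤ α / 2 := by
    calc N * η ≤ N * (α / (2 * N)) := by gcongr; exact min_le_left _ _
      _ = α / 2 := by field_simp
  have hηb : N * η * γ / (1 - lam) ≤ δ * α / 4 := by
    calc N * η * γ / (1 - lam) ≤ N * (δ * α * (1 - lam) / (4 * N * γ)) * γ / (1 - lam) := by
          gcongr; exact min_le_right _ _
      _ = δ * α / 4 := by field_simp
  have hη1 : η < 1 := by nlinarith [hα.2]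
  refine ⟨η, ⟨hη0, hη1⟩, ?_⟩
  intro ρ hρ u Du hu hDu hw hD hA
  have hKm : MeasurableSet (cube N 0 ρ) := (isOpen_cube N 0 ρ).measurableSet
  set K := cube N 0 ρ with hK
  let m := hu.aestronglyMeasurable.mk u
  have hmm : Measurable m := hu.aestronglyMeasurable.stronglyMeasurable_mk.measurable
  have hum : u =ᵐ[volume.restrict K] m := hu.aestronglyMeasurable.ae_eq_mk
  let u' := K.indicator m
  have hu'K : ∀ x ∈ K, u' x = m x := fun x hx => indicator_of_mem hx m
  have hae : ∀ᵐ x ∂volume, x ∈ K → u x = u' x := by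
    filter_upwards [(ae_restrict_iff' hKm).1 hum] with x hx hxK
    rw [hx hxK, hu'K x hxK]
  have hae' : u =ᵐ[volume.restrict K] u' := (ae_restrict_iff' hKm).2 hae
  have hu'int : Integrable u' := by
    rw [integrable_indicator_iff hKm]
    exact hu.congr hum
  have hvol : ∀ (S : Set (EuclideanSpace ℝ (Fin N))) (c : ℝ), S ⊆ K →
      volume {x ∈ S | c < u x} = volume {x ∈ S | c < u' x} := by
    intro S c hS
    apply measure_congr
    filter_upwards [hae] with x hx
    apply propext
    change (x ∈ S ∧ c < u x) ↔ (x ∈ S ∧ c < u' x)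
    refine and_congr_right fun h => ?_
    rw [hx (hS h)]
  obtain ⟨x0, hx0, hx1⟩ := core N hN γ α δ lam η hγ hα hδ hlam hη0 hη1 hηa hηb ρ hρ u' Du
    (hmm.indicator hKm) hu'int (fun x hx => indicator_of_notMem hx m) hDu
    (by
      intro φ h1 h2 h3 i
      rw [← hw φ h1 h2 h3 i]
      apply integral_congr_ae
      filter_upwards [hae'] with x hx
      rw [hx]) hD
    (by rw [← hvol _ _ subset_rfl]; exact hA)
  exact ⟨x0, hx0, by rw [hvol _ _ hx0]; exact hx1⟩
end
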